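/- arXiv:2508.04813 — 6 statements merged into one kernel-verified Lean document; each statement's English description precedes it below -/
import Mathlib

section
/- Let d ≥ 2 be an integer and let F=(F₁,F₂,F₃) be a triple of complete flags in ℂ^d in general position. Then there exists a basis of ℂ^d adapted to F; moreover, if (g₁,…,g_d) and (g₁',…,g_d') are both adapted to F, then there is a single scalar c ∈ ℂ∖{0} with g_m' = c·g_m for every m∈{1,…,d}. -/
open scoped BigOperators

/-- A complete flag in `ℂ^d`, recorded by its chain of subspaces
`{0} = F^0 ⊆ F^1 ⊆ ⋯ ⊆ F^d = ℂ^d` with `dim F^k = k` (the values for `k > d` are `⊤`). -/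
structure CompleteFlag (d : ℕ) where
  space : ℕ → Submodule ℂ (Fin d → ℂ)
  mono : Monotone space
  finrank_eq : ∀ k, k ≤ d → Module.finrank ℂ (space k) = k
  eq_top : ∀ k, d ≤ k → space k = ⊤

/-- A tuple of complete flags is in general position if
`F₁^{k₁} + ⋯ + F_m^{k_m} = ℂ^d` whenever `k₁ + ⋯ + k_m = d`. -/
def GenPos {d m : ℕ} (F : Fin m → CompleteFlag d) : Prop :=
  ∀ k : Fin m → ℕ, (∑ i, k i) = d → (⨆ i, (F i).space (k i)) = ⊤


/-- `v 1, …, v d` is a basis of `ℂ^d` (values of `v` outside `{1, …, d}` are irrelevant). -/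
def IsBasisFam (d : ℕ) (v : ℕ → (Fin d → ℂ)) : Prop :=
  LinearIndependent ℂ (fun i : Fin d => v ((i : ℕ) + 1)) ∧
    Submodule.span ℂ (v '' Set.Icc 1 d) = ⊤

/-- The basis `v 1, …, v d` of `ℂ^d` is adapted to the triple of flags `(F₁, F₂, F₃)`:
`v m ∈ F₁^m ∩ F₃^{d-m+1}` for `1 ≤ m ≤ d` and `v 1 + ⋯ + v d ∈ F₂^1`. -/
def AdaptedBasis {d : ℕ} (F₁ F₂ F₃ : CompleteFlag d) (v : ℕ → (Fin d → ℂ)) : Prop :=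
  IsBasisFam d v ∧
    (∀ m, 1 ≤ m → m ≤ d → v m ∈ F₁.space m ⊓ F₃.space (d - m + 1)) ∧
    (∑ m ∈ Finset.Icc 1 d, v m) ∈ F₂.space 1

open Module

namespace CompleteFlag

variable {d : ℕ}

lemma space_zero (F : CompleteFlag d) : F.space 0 = ⊥ :=
  Submodule.finrank_eq_zero.mp (F.finrank_eq 0 d.zero_le)

lemma finrank_inf_of_sup_eq_top {A C : CompleteFlag d} {k l : ℕ} (hk : k ≤ d) (hl : l ≤ d)
    (h : A.space k ⊔ C.space l = ⊤) :
    finrank ℂ ↥(A.space k ⊓ C.space l) + d = k + l := by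
  have := Submodule.finrank_sup_add_finrank_inf_eq (A.space k) (C.space l)
  rw [h, A.finrank_eq k hk, C.finrank_eq l hl, finrank_top, finrank_fin_fun] at this
  omega

lemma inf_eq_bot {A C : CompleteFlag d} {k l : ℕ} (hkl : k + l = d)
    (h : A.space k ⊔ C.space l = ⊤) : A.space k ⊓ C.space l = ⊥ := by
  have := finrank_inf_of_sup_eq_top (by omega) (by omega) h
  exact Submodule.finrank_eq_zero.mp (by omega)

lemma finrank_inf_eq_one {A C : CompleteFlag d}
    (hAC : ∀ k l, k + l = d → A.space k ⊔ C.space l = ⊤) {m : ℕ} (hm : 1 ≤ m) (hmd : m ≤ d) :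
    finrank ℂ ↥(A.space m ⊓ C.space (d - m + 1)) = 1 := by
  have htop : A.space m ⊔ C.space (d - m + 1) = ⊤ :=
    top_unique <| (hAC m (d - m) (by omega)).ge.trans <|
      sup_le_sup_left (C.mono (Nat.le_succ _)) _
  have := finrank_inf_of_sup_eq_top hmd (by omega) htop
  omega

lemma span_image_Icc (A : CompleteFlag d) {v : ℕ → Fin d → ℂ}
    (hv : ∀ m, m < d → v (m + 1) ∈ A.space (m + 1) ∧ v (m + 1) ∉ A.space m) :
    ∀ m, m ≤ d → Submodule.span ℂ (v '' Set.Icc 1 m) = A.space m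
  | 0, _ => by simp [space_zero]
  | m + 1, hm => by
    have ih := span_image_Icc A hv m (by omega)
    obtain ⟨hmem, hnot⟩ := hv m hm
    rw [← Set.insert_Icc_right_eq_Icc_add_one (by omega), Set.image_insert_eq,
      Submodule.span_insert, ih]
    refine Submodule.eq_of_le_of_finrank_le
      (sup_le ((Submodule.span_singleton_le_iff_mem _ _).mpr hmem) (A.mono (Nat.le_succ m))) ?_
    have hlt : A.space m < ℂ ∙ v (m + 1) ⊔ A.space m :=
      lt_of_le_of_ne le_sup_right fun h =>
        hnot (h ▸ Submodule.mem_sup_left (Submodule.mem_span_singleton_self _))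
    have := Submodule.finrank_lt_finrank_of_lt hlt
    rw [A.finrank_eq m (by omega)] at this
    rw [A.finrank_eq _ hm]
    omega

lemma isBasisFam_of_mem_inf {A C : CompleteFlag d}
    (hAC : ∀ k l, k + l = d → A.space k ⊔ C.space l = ⊤) {v : ℕ → Fin d → ℂ}
    (hv : ∀ m, 1 ≤ m → m ≤ d → v m ∈ A.space m ⊓ C.space (d - m + 1))
    (hv0 : ∀ m, 1 ≤ m → m ≤ d → v m ≠ 0) : IsBasisFam d v := by
  have hspan : Submodule.span ℂ (v '' Set.Icc 1 d) = ⊤ := by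
    rw [A.span_image_Icc _ d le_rfl, A.eq_top d le_rfl]
    intro m hm
    have hmem := hv (m + 1) (by omega) hm
    refine ⟨hmem.1, fun h => hv0 (m + 1) (by omega) hm ?_⟩
    have hbot := inf_eq_bot (by omega) (hAC m (d - (m + 1) + 1) (by omega))
    exact (Submodule.mem_bot ℂ).mp (hbot ▸ ⟨h, hmem.2⟩)
  refine ⟨linearIndependent_of_top_le_span_of_card_eq_finrank ?_ (by simp), hspan⟩
  rw [← hspan]
  refine Submodule.span_mono ?_
  rintro _ ⟨m, hm, rfl⟩
  obtain ⟨h1, h2⟩ := Set.mem_Icc.mp hm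
  exact ⟨⟨m - 1, by omega⟩, by simp only [Nat.sub_add_cancel h1]⟩

end CompleteFlag

lemma GenPos.sup_eq_top {d : ℕ} {A B C : CompleteFlag d} (h : GenPos ![A, B, C]) {k l m : ℕ}
    (hklm : k + l + m = d) : A.space k ⊔ B.space l ⊔ C.space m = ⊤ := by
  have := h ![k, l, m] (by simpa [Fin.sum_univ_three] using hklm)
  rw [eq_top_iff, ← this]
  refine iSup_le fun i => ?_
  fin_cases i
  · exact le_sup_left.trans le_sup_left
  · exact le_sup_right.trans le_sup_left
  · exact le_sup_right

lemma GenPos.sup_eq_top_of_add {d : ℕ} {A B C : CompleteFlag d} (h : GenPos ![A, B, C])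
    (k l : ℕ) (hkl : k + l = d) : A.space k ⊔ C.space l = ⊤ := by
  simpa [B.space_zero] using h.sup_eq_top (l := 0) (by omega : k + 0 + l = d)

/-- A line of the middle flag is not contained in a hyperplane spanned by the outer flags. -/
lemma GenPos.notMem_sup {d : ℕ} {A B C : CompleteFlag d} (h : GenPos ![A, B, C])
    {w : Fin d → ℂ} (hw : B.space 1 = ℂ ∙ w) {k l : ℕ} (hkl : k + 1 + l = d) :
    w ∉ A.space k ⊔ C.space l := by
  intro hmem
  have htop : A.space k ⊔ C.space l = ⊤ := by
    rw [← h.sup_eq_top hkl, hw, sup_right_comm, left_eq_sup]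
    exact (Submodule.span_singleton_le_iff_mem _ _).mpr hmem
  have := CompleteFlag.finrank_inf_of_sup_eq_top (by omega) (by omega) htop
  omega

lemma IsBasisFam.coeff_eq_zero {d : ℕ} {v : ℕ → Fin d → ℂ} (hv : IsBasisFam d v) {a : ℕ → ℂ}
    (ha : ∑ m ∈ Finset.Icc 1 d, a m • v m = 0) {m : ℕ} (hm : 1 ≤ m) (hmd : m ≤ d) : a m = 0 := by
  have hsum : ∑ i : Fin d, a (i + 1) • v (i + 1) = 0 := by
    rw [← ha, ← Finset.sum_range fun i => a (i + 1) • v (i + 1), Finset.range_eq_Ico,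
      Finset.sum_Ico_add' (fun i => a i • v i)]
    rfl
  have := Fintype.linearIndependent_iff.mp hv.1 (fun i => a (i + 1)) hsum ⟨m - 1, by omega⟩
  simpa only [Nat.sub_add_cancel hm] using this

lemma IsBasisFam.ne_zero {d : ℕ} {v : ℕ → Fin d → ℂ} (hv : IsBasisFam d v) {m : ℕ}
    (hm : 1 ≤ m) (hmd : m ≤ d) : v m ≠ 0 := by
  simpa only [Nat.sub_add_cancel hm] using hv.1.ne_zero ⟨m - 1, by omega⟩

lemma Submodule.exists_smul_eq_of_finrank_eq_one {K V : Type*} [Field K] [AddCommGroup V]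
    [Module K V] {L : Submodule K V} (hL : finrank K L = 1) {x y : V} (hx : x ∈ L) (hx0 : x ≠ 0)
    (hy : y ∈ L) : ∃ c : K, c • x = y := by
  obtain ⟨c, hc⟩ := (finrank_eq_one_iff_of_nonzero' (⟨x, hx⟩ : L)
    (by simpa [Subtype.ext_iff] using hx0)).mp hL ⟨y, hy⟩
  exact ⟨c, congrArg Subtype.val hc⟩

lemma Submodule.exists_ne_zero_of_finrank_eq_one {K V : Type*} [Field K] [AddCommGroup V]
    [Module K V] {L : Submodule K V} (hL : finrank K L = 1) : ∃ x ∈ L, x ≠ 0 :=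
  L.exists_mem_ne_zero_of_ne_bot (by rintro rfl; simp at hL)

lemma GenPos.exists_adaptedBasis {d : ℕ} (hd : 1 ≤ d) {A B C : CompleteFlag d}
    (h : GenPos ![A, B, C]) : ∃ v, AdaptedBasis A B C v := by
  have hAC := h.sup_eq_top_of_add
  have hex : ∀ m, ∃ u : Fin d → ℂ, 1 ≤ m → m ≤ d →
      u ∈ A.space m ⊓ C.space (d - m + 1) ∧ u ≠ 0 := by
    intro m
    by_cases hm : 1 ≤ m ∧ m ≤ d
    · obtain ⟨u, hu⟩ := Submodule.exists_ne_zero_of_finrank_eq_one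
        (CompleteFlag.finrank_inf_eq_one hAC hm.1 hm.2)
      exact ⟨u, fun _ _ => hu⟩
    · exact ⟨0, fun h1 h2 => absurd ⟨h1, h2⟩ hm⟩
  choose u hu using hex
  have hbasis : IsBasisFam d u := CompleteFlag.isBasisFam_of_mem_inf hAC
    (fun m h1 h2 => (hu m h1 h2).1) fun m h1 h2 => (hu m h1 h2).2
  obtain ⟨w, hwB, hw0⟩ := Submodule.exists_ne_zero_of_finrank_eq_one (B.finrank_eq 1 hd)
  have hBw : B.space 1 = ℂ ∙ w := by
    refine le_antisymm (fun y hy => ?_) ((Submodule.span_singleton_le_iff_mem _ _).mpr hwB)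
    exact Submodule.mem_span_singleton.mpr
      (Submodule.exists_smul_eq_of_finrank_eq_one (B.finrank_eq 1 hd) hwB hw0 hy)
  have hwspan : w ∈ Submodule.span ℂ (u '' ((Finset.Icc 1 d : Finset ℕ) : Set ℕ)) := by
    rw [Finset.coe_Icc, hbasis.2]
    exact Submodule.mem_top
  obtain ⟨a, ha⟩ := (Submodule.mem_span_image_finset_iff_exists_fun' ℂ).mp hwspan
  have ha0 : ∀ m, 1 ≤ m → m ≤ d → a m ≠ 0 := by
    intro m h1 h2 ham
    refine h.notMem_sup hBw (by omega : (m - 1) + 1 + (d - m) = d) ?_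
    rw [← ha]
    refine Submodule.sum_mem _ fun j hj => ?_
    obtain ⟨hj1, hjd⟩ := Finset.mem_Icc.mp hj
    obtain ⟨hjA, hjC⟩ := (hu j hj1 hjd).1
    rcases lt_trichotomy j m with hlt | rfl | hgt
    · exact Submodule.smul_mem _ _ (Submodule.mem_sup_left (A.mono (by omega) hjA))
    · simp [ham]
    · exact Submodule.smul_mem _ _ (Submodule.mem_sup_right (C.mono (by omega) hjC))
  have hmem : ∀ m, 1 ≤ m → m ≤ d → a m • u m ∈ A.space m ⊓ C.space (d - m + 1) :=
    fun m h1 h2 => Submodule.smul_mem _ _ (hu m h1 h2).1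
  exact ⟨fun m => a m • u m, CompleteFlag.isBasisFam_of_mem_inf hAC hmem
    fun m h1 h2 => smul_ne_zero (ha0 m h1 h2) (hu m h1 h2).2, hmem, ha ▸ hwB⟩

lemma GenPos.adaptedBasis_unique {d : ℕ} (hd : 1 ≤ d) {A B C : CompleteFlag d}
    (h : GenPos ![A, B, C]) {v v' : ℕ → Fin d → ℂ} (hv : AdaptedBasis A B C v)
    (hv' : AdaptedBasis A B C v') :
    ∃ c : ℂ, c ≠ 0 ∧ ∀ m, 1 ≤ m → m ≤ d → v' m = c • v m := by
  obtain ⟨hbasis, hmem, hsum⟩ := hv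
  obtain ⟨hbasis', hmem', hsum'⟩ := hv'
  have hs0 : ∑ m ∈ Finset.Icc 1 d, v m ≠ 0 := fun h0 =>
    one_ne_zero (hbasis.coeff_eq_zero (a := fun _ => 1) (by simpa using h0) le_rfl hd)
  obtain ⟨c, hc⟩ :=
    Submodule.exists_smul_eq_of_finrank_eq_one (B.finrank_eq 1 hd) hsum hs0 hsum'
  have hex : ∀ m, ∃ b : ℂ, 1 ≤ m → m ≤ d → b • v m = v' m := by
    intro m
    by_cases hm : 1 ≤ m ∧ m ≤ d
    · obtain ⟨b, hb⟩ := Submodule.exists_smul_eq_of_finrank_eq_one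
        (CompleteFlag.finrank_inf_eq_one h.sup_eq_top_of_add hm.1 hm.2)
        (hmem m hm.1 hm.2) (hbasis.ne_zero hm.1 hm.2) (hmem' m hm.1 hm.2)
      exact ⟨b, fun _ _ => hb⟩
    · exact ⟨0, fun h1 h2 => absurd ⟨h1, h2⟩ hm⟩
  choose b hb using hex
  have hzero : ∑ m ∈ Finset.Icc 1 d, (b m - c) • v m = 0 := by
    simp_rw [sub_smul]
    rw [Finset.sum_sub_distrib, ← Finset.smul_sum, hc, sub_eq_zero]
    exact Finset.sum_congr rfl fun m hm => hb m (Finset.mem_Icc.mp hm).1 (Finset.mem_Icc.mp hm).2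
  have heq : ∀ m, 1 ≤ m → m ≤ d → v' m = c • v m := fun m h1 h2 => by
    rw [← hb m h1 h2, sub_eq_zero.mp (hbasis.coeff_eq_zero hzero h1 h2)]
  refine ⟨c, ?_, heq⟩
  rintro rfl
  exact hbasis'.ne_zero le_rfl hd (by simpa using heq 1 le_rfl hd)

/-- every triple of complete flags in general position admits an adapted basis,
and any two adapted bases differ by a single nonzero scalar. -/
theorem adaptedBasis_exists_and_unique_up_to_scalar
    (d : ℕ) (hd : 2 ≤ d) (F₁ F₂ F₃ : CompleteFlag d) (hF : GenPos ![F₁, F₂, F₃]) :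
    (∃ v : ℕ → (Fin d → ℂ), AdaptedBasis F₁ F₂ F₃ v) ∧
    (∀ v v' : ℕ → (Fin d → ℂ), AdaptedBasis F₁ F₂ F₃ v → AdaptedBasis F₁ F₂ F₃ v' →
      ∃ c : ℂ, c ≠ 0 ∧ ∀ m, 1 ≤ m → m ≤ d → v' m = c • v m) :=
  ⟨hF.exists_adaptedBasis (by omega), fun _ _ => hF.adaptedBasis_unique (by omega)⟩
end

section
/- Let d ≥ 2 be an integer and let F=(F₁,F₂,F₃) be a triple of complete flags in ℂ^d in general position such that T^j(F₁,F₂,F₃) = 1 for every j ∈ ℬ. Let u ∈ SL_d(ℂ) be a unipotent linear map with u·F₂ = F₂ and u·F₁ = F₃, and let (f₁,…,f_d) and (f₁',…,f_d') be bases of ℂ^d adapted to (F₂,F₃,F₁) and to (F₃,F₁,F₂) respectively, with f₁ = f_d'. Then u(f_m) = (−1)^{m−1} f_{d−m+1}' for every m∈{1,…,d}. -/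
open scoped BigOperators

/-- The exterior algebra of `ℂ^d`. -/
abbrev ExtAlg (d : ℕ) := ExteriorAlgebra ℂ (Fin d → ℂ)

/-- The image of `⋀^k (F^k)` inside the exterior algebra of `ℂ^d`. -/
noncomputable def flagPower {d : ℕ} (F : CompleteFlag d) (k : ℕ) : Submodule ℂ (ExtAlg d) :=
  (Submodule.map (ExteriorAlgebra.ι ℂ) (F.space k)) ^ k

/-- The top exterior power `⋀^d (ℂ^d)` inside the exterior algebra. -/
noncomputable def topPower (d : ℕ) : Submodule ℂ (ExtAlg d) :=
  (LinearMap.range (ExteriorAlgebra.ι ℂ : (Fin d → ℂ) →ₗ[ℂ] ExtAlg d)) ^ d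

/-- A linear functional realizing a fixed isomorphism `⋀^d (ℂ^d) ≅ ℂ`,
i.e. injective on the top exterior power. -/
def IsTopIso {d : ℕ} (φ : ExtAlg d →ₗ[ℂ] ℂ) : Prop :=
  ∀ x ∈ topPower d, φ x = 0 → x = 0

/-- A choice, for each `k ≤ d`, of a nonzero element `f^k ∈ ⋀^k (F^k)`. -/
def IsFlagChoice {d : ℕ} (F : CompleteFlag d) (f : ℕ → ExtAlg d) : Prop :=
  ∀ k, k ≤ d → f k ∈ flagPower F k ∧ f k ≠ 0

/-- A canonical choice of a nonzero element of `⋀^k (F^k)`. -/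
noncomputable def flagElt {d : ℕ} (F : CompleteFlag d) (k : ℕ) : ExtAlg d :=
  open scoped Classical in
  if h : ∃ x, x ∈ flagPower F k ∧ x ≠ 0 then h.choose else 0

/-- The triple ratio computed from given choices `f₁, f₂, f₃` of elements. -/
noncomputable def tripleRatioOf {d : ℕ} (φ : ExtAlg d →ₗ[ℂ] ℂ) (f₁ f₂ f₃ : ℕ → ExtAlg d)
    (j : ℕ × ℕ × ℕ) : ℂ :=
  (φ (f₁ (j.1 + 1) * f₂ j.2.1 * f₃ (j.2.2 - 1)) *
   φ (f₁ j.1 * f₂ (j.2.1 - 1) * f₃ (j.2.2 + 1)) *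
   φ (f₁ (j.1 - 1) * f₂ (j.2.1 + 1) * f₃ j.2.2)) /
  (φ (f₁ (j.1 - 1) * f₂ j.2.1 * f₃ (j.2.2 + 1)) *
   φ (f₁ j.1 * f₂ (j.2.1 + 1) * f₃ (j.2.2 - 1)) *
   φ (f₁ (j.1 + 1) * f₂ (j.2.1 - 1) * f₃ j.2.2))

/-- The `j`-triple ratio `T^j(F₁,F₂,F₃)`. -/
noncomputable def tripleRatio {d : ℕ} (φ : ExtAlg d →ₗ[ℂ] ℂ) (F₁ F₂ F₃ : CompleteFlag d)
    (j : ℕ × ℕ × ℕ) : ℂ :=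
  tripleRatioOf φ (flagElt F₁) (flagElt F₂) (flagElt F₃) j

/-- The double ratio computed from given choices of elements. -/
noncomputable def doubleRatioOf {d : ℕ} (φ : ExtAlg d →ₗ[ℂ] ℂ) (g₁ g₂ h₁ h₂ : ℕ → ExtAlg d)
    (i : ℕ × ℕ) : ℂ :=
  -((φ (g₁ i.1 * g₂ (i.2 - 1) * h₁ 1) * φ (g₁ (i.1 - 1) * g₂ i.2 * h₂ 1)) /
    (φ (g₁ i.1 * g₂ (i.2 - 1) * h₂ 1) * φ (g₁ (i.1 - 1) * g₂ i.2 * h₁ 1)))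

/-- The `i`-double ratio `D^i(G₁,G₂,H₁,H₂)`. -/
noncomputable def doubleRatio {d : ℕ} (φ : ExtAlg d →ₗ[ℂ] ℂ) (G₁ G₂ H₁ H₂ : CompleteFlag d)
    (i : ℕ × ℕ) : ℂ :=
  doubleRatioOf φ (flagElt G₁) (flagElt G₂) (flagElt H₁) (flagElt H₂) i

/-- `𝒜`: pairs of positive integers summing to `d`. -/
def Aset (d : ℕ) : Finset (ℕ × ℕ) :=
  (Finset.range (d + 1) ×ˢ Finset.range (d + 1)).filter
    fun i => 0 < i.1 ∧ 0 < i.2 ∧ i.1 + i.2 = d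

/-- `ℬ`: triples of positive integers summing to `d`. -/
def Bset (d : ℕ) : Finset (ℕ × ℕ × ℕ) :=
  (Finset.range (d + 1) ×ˢ Finset.range (d + 1) ×ˢ Finset.range (d + 1)).filter
    fun j => 0 < j.1 ∧ 0 < j.2.1 ∧ 0 < j.2.2 ∧ j.1 + j.2.1 + j.2.2 = d


section ExteriorPowers

variable {K V : Type*} [Field K] [AddCommGroup V] [Module K V]

theorem finrank_map_ι_pow [Module.Finite K V] (W : Submodule K V) (k : ℕ) :
    Module.finrank K ((W.map (ExteriorAlgebra.ι K)) ^ k : Submodule K (ExteriorAlgebra K V)) =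
      (Module.finrank K W).choose k := by
  have h : (W.map (ExteriorAlgebra.ι K)) ^ k =
      (⋀[K]^k W).map (ExteriorAlgebra.map W.subtype).toLinearMap := by
    rw [ExteriorAlgebra.exteriorPower, Submodule.map_pow]
    congr 1
    ext x
    simp
  have hinj : Function.Injective (ExteriorAlgebra.map W.subtype).toLinearMap :=
    ExteriorAlgebra.map_injective_field W.ker_subtype
  rw [h, ← (Submodule.equivMapOfInjective _ hinj _).finrank_eq, exteriorPower.finrank_eq]

theorem map_ι_pow_eq_bot [Module.Finite K V] (W : Submodule K V) {k : ℕ}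
    (hk : Module.finrank K W < k) : (W.map (ExteriorAlgebra.ι K)) ^ k = ⊥ := by
  have : Module.Finite K ((W.map (ExteriorAlgebra.ι K)) ^ k :
      Submodule K (ExteriorAlgebra K V)) :=
    Module.Finite.iff_fg.mpr ((Module.Finite.iff_fg.mp inferInstance).pow k)
  rw [← Submodule.finrank_eq_zero (R := K), finrank_map_ι_pow, Nat.choose_eq_zero_of_lt hk]

theorem ι_mul_eq_neg_one_pow_smul (v : V) {W : Submodule K V} {k : ℕ} {x : ExteriorAlgebra K V}
    (hx : x ∈ (W.map (ExteriorAlgebra.ι K)) ^ k) :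
    ExteriorAlgebra.ι K v * x = (-1 : K) ^ k • (x * ExteriorAlgebra.ι K v) := by
  induction hx using Submodule.pow_induction_on_left' with
  | algebraMap r => simp [Algebra.commutes]
  | add x y i hx hy h₁ h₂ => rw [mul_add, h₁, h₂, add_mul, smul_add]
  | mem_mul m hm i x hx h =>
    obtain ⟨w, -, rfl⟩ := hm
    rw [← mul_assoc, eq_neg_of_add_eq_zero_left (ExteriorAlgebra.ι_add_mul_swap v w), neg_mul,
      mul_assoc, h, mul_smul_comm, mul_assoc, pow_succ, mul_neg_one, neg_smul]

theorem commute_map_ι (W W' : Submodule K V) :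
    Commute (W.map (ExteriorAlgebra.ι K)) (W'.map (ExteriorAlgebra.ι K)) := by
  have key : ∀ W W' : Submodule K V, W.map (ExteriorAlgebra.ι K) * W'.map (ExteriorAlgebra.ι K) ≤
      W'.map (ExteriorAlgebra.ι K) * W.map (ExteriorAlgebra.ι K) := by
    intro W W'
    rw [Submodule.mul_le]
    rintro _ ⟨v, hv, rfl⟩ _ ⟨w, hw, rfl⟩
    rw [eq_neg_of_add_eq_zero_left (ExteriorAlgebra.ι_add_mul_swap v w)]
    exact neg_mem (Submodule.mul_mem_mul ⟨w, hw, rfl⟩ ⟨v, hv, rfl⟩)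
  exact le_antisymm (key _ _) (key _ _)

theorem add_add_pow_eq_zero {R : Type*} [Semiring R] {A B C : R} (hAB : Commute A B)
    (hAC : Commute A C) (hBC : Commute B C) {a b c : ℕ} (hA : ∀ i, a < i → A ^ i = 0)
    (hB : ∀ i, b < i → B ^ i = 0) (hC : ∀ i, c < i → C ^ i = 0)
    (h : A ^ a * B ^ b * C ^ c = 0) : (A + B + C) ^ (a + b + c) = 0 := by
  rw [(hAC.add_left hBC).add_pow]
  refine Finset.sum_eq_zero fun i hi => ?_
  rw [Finset.mem_range] at hi
  rw [hAB.add_pow, Finset.sum_mul, Finset.sum_mul]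
  refine Finset.sum_eq_zero fun j hj => ?_
  rw [Finset.mem_range] at hj
  have h0 : A ^ j * B ^ (i - j) * C ^ (a + b + c - i) = 0 := by
    by_cases h₁ : a < j
    · simp [hA j h₁]
    by_cases h₂ : b < i - j
    · simp [hB _ h₂]
    by_cases h₃ : c < a + b + c - i
    · simp [hC _ h₃]
    rw [show j = a by omega, show i - a = b by omega, show a + b + c - i = c by omega, h]
  rw [(Nat.cast_commute _ (C ^ _)).right_comm, h0, zero_mul, zero_mul]

theorem map_ι_pow_mul_pow_mul_pow_ne_bot [Module.Finite K V] {W₁ W₂ W₃ : Submodule K V}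
    (htop : W₁ ⊔ W₂ ⊔ W₃ = ⊤)
    (hrank : Module.finrank K W₁ + Module.finrank K W₂ + Module.finrank K W₃ =
      Module.finrank K V) :
    (W₁.map (ExteriorAlgebra.ι K)) ^ Module.finrank K W₁ *
      (W₂.map (ExteriorAlgebra.ι K)) ^ Module.finrank K W₂ *
      (W₃.map (ExteriorAlgebra.ι K)) ^ Module.finrank K W₃ ≠ ⊥ := by
  intro h
  have h0 := add_add_pow_eq_zero (commute_map_ι W₁ W₂) (commute_map_ι W₁ W₃)
    (commute_map_ι W₂ W₃) (fun _ => map_ι_pow_eq_bot W₁) (fun _ => map_ι_pow_eq_bot W₂)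
    (fun _ => map_ι_pow_eq_bot W₃) h
  rw [Submodule.add_eq_sup, Submodule.add_eq_sup, ← Submodule.map_sup, ← Submodule.map_sup, htop,
    hrank] at h0
  have h1 := finrank_map_ι_pow (⊤ : Submodule K V) (Module.finrank K V)
  rw [h0, finrank_top, Nat.choose_self, Submodule.zero_eq_bot, finrank_bot] at h1
  exact zero_ne_one h1

end ExteriorPowers

section Flags

variable {d : ℕ}

theorem flagElt_mem_and_ne_zero (F : CompleteFlag d) {k : ℕ} (hk : k ≤ d) :
    flagElt F k ∈ flagPower F k ∧ flagElt F k ≠ 0 := by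
  have h : ∃ x, x ∈ flagPower F k ∧ x ≠ 0 := by
    by_contra! h
    have h1 := finrank_map_ι_pow (F.space k) k
    rw [F.finrank_eq k hk, Nat.choose_self, ← flagPower, (Submodule.eq_bot_iff _).2 h,
      finrank_bot] at h1
    exact zero_ne_one h1
  rw [flagElt, dif_pos h]
  exact h.choose_spec

theorem exists_eq_smul_flagElt (F : CompleteFlag d) {k : ℕ} (hk : k ≤ d) {x : ExtAlg d}
    (hx : x ∈ flagPower F k) : ∃ c : ℂ, x = c • flagElt F k := by
  have h1 := finrank_map_ι_pow (F.space k) k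
  rw [F.finrank_eq k hk, Nat.choose_self, ← flagPower] at h1
  obtain ⟨hm, h0⟩ := flagElt_mem_and_ne_zero F hk
  obtain ⟨c, hc⟩ := (finrank_eq_one_iff_of_nonzero' (⟨_, hm⟩ : flagPower F k)
    (by simpa using h0)).1 h1 ⟨x, hx⟩
  exact ⟨c, (congrArg Subtype.val hc).symm⟩

theorem flagElt_mul_ι_mem (F : CompleteFlag d) {k : ℕ} (hk : k + 1 ≤ d) {v : Fin d → ℂ}
    (hv : v ∈ F.space (k + 1)) :
    flagElt F k * ExteriorAlgebra.ι ℂ v ∈ flagPower F (k + 1) := by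
  rw [flagPower, pow_succ]
  exact Submodule.mul_mem_mul (pow_le_pow_left'
    (Submodule.map_mono (F.mono k.le_succ)) _ (flagElt_mem_and_ne_zero F (by omega)).1)
    (Submodule.mem_map_of_mem hv)

theorem flagElt_mul_ι_eq_zero (F : CompleteFlag d) {k : ℕ} (hk : k ≤ d) {v : Fin d → ℂ}
    (hv : v ∈ F.space k) : flagElt F k * ExteriorAlgebra.ι ℂ v = 0 := by
  have h := Submodule.mul_mem_mul (flagElt_mem_and_ne_zero F hk).1
    (Submodule.mem_map_of_mem (f := ExteriorAlgebra.ι ℂ) hv)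
  rw [flagPower, ← pow_succ, map_ι_pow_eq_bot] at h
  · simpa using h
  · rw [F.finrank_eq k hk]; omega

theorem ι_mul_flagElt (F : CompleteFlag d) {k : ℕ} (hk : k ≤ d) (v : Fin d → ℂ) :
    ExteriorAlgebra.ι ℂ v * flagElt F k = (-1 : ℂ) ^ k • (flagElt F k * ExteriorAlgebra.ι ℂ v) :=
  ι_mul_eq_neg_one_pow_smul v (flagElt_mem_and_ne_zero F hk).1

/-- The coordinate of `v mod F^k` in the line `F^(k+1) / F^k`, read off from `f^k ∧ v`. -/
theorem exists_flagElt_mul_ι_eq_smul (F : CompleteFlag d) {k : ℕ} (hk : k + 1 ≤ d)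
    {v : Fin d → ℂ} (hv : v ∈ F.space (k + 1)) :
    ∃ c : ℂ, flagElt F k * ExteriorAlgebra.ι ℂ v = c • flagElt F (k + 1) :=
  exists_eq_smul_flagElt F hk (flagElt_mul_ι_mem F hk hv)

theorem sup_span_singleton_eq (F : CompleteFlag d) {k : ℕ} (hk : k + 1 ≤ d) {v : Fin d → ℂ}
    (hv : v ∈ F.space (k + 1)) (hv' : v ∉ F.space k) :
    F.space k ⊔ Submodule.span ℂ {v} = F.space (k + 1) := by
  have hle : F.space k ⊔ Submodule.span ℂ {v} ≤ F.space (k + 1) :=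
    sup_le (F.mono k.le_succ) (by simpa using hv)
  have hlt : F.space k < F.space k ⊔ Submodule.span ℂ {v} :=
    lt_of_le_of_ne le_sup_left fun h => hv' (h ▸ Submodule.mem_sup_right
      (Submodule.mem_span_singleton_self v))
  have h1 := Submodule.finrank_lt_finrank_of_lt hlt
  refine Submodule.eq_of_le_of_finrank_le hle ?_
  rw [F.finrank_eq _ (by omega)] at h1 ⊢
  omega

theorem mem_of_flagElt_mul_ι_eq_zero (F : CompleteFlag d) {k : ℕ} (hk : k + 1 ≤ d)
    {g w : Fin d → ℂ} (hg : g ∈ F.space (k + 1))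
    (hg' : flagElt F k * ExteriorAlgebra.ι ℂ g ≠ 0) (hw : w ∈ F.space (k + 1))
    (hw' : flagElt F k * ExteriorAlgebra.ι ℂ w = 0) : w ∈ F.space k := by
  rw [← sup_span_singleton_eq F hk hg fun h => hg' (flagElt_mul_ι_eq_zero F (by omega) h)] at hw
  obtain ⟨x, hx, y, hy, rfl⟩ := Submodule.mem_sup.1 hw
  obtain ⟨c, rfl⟩ := Submodule.mem_span_singleton.1 hy
  rw [map_add, mul_add, flagElt_mul_ι_eq_zero F (by omega) hx, zero_add, map_smul,
    mul_smul_comm, smul_eq_zero, or_iff_left hg'] at hw'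
  simpa [hw'] using hx

/-- A unipotent map preserving a flag acts trivially on its one-dimensional quotients. -/
theorem sub_mem_of_isNilpotent (F : CompleteFlag d) {u : Module.End ℂ (Fin d → ℂ)}
    (hu : IsNilpotent (u - 1)) (hF : ∀ k, Submodule.map u (F.space k) = F.space k) {k : ℕ}
    (hk : k + 1 ≤ d) {g : Fin d → ℂ} (hg : g ∈ F.space (k + 1)) : u g - g ∈ F.space k := by
  by_cases hg' : g ∈ F.space k
  · exact sub_mem (hF k ▸ Submodule.mem_map_of_mem hg') hg'
  have hN : ∀ j, ∀ v ∈ F.space j, (u - 1) v ∈ F.space j := fun j v hv =>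
    sub_mem (hF j ▸ Submodule.mem_map_of_mem hv) hv
  have h := hN _ _ hg
  rw [← sup_span_singleton_eq F hk hg hg'] at h
  obtain ⟨x, hx, y, hy, hxy⟩ := Submodule.mem_sup.1 h
  obtain ⟨c, rfl⟩ := Submodule.mem_span_singleton.1 hy
  have hpow : ∀ n, ((u - 1) ^ n) g - c ^ n • g ∈ F.space k := by
    intro n
    induction n with
    | zero => simp
    | succ n ih =>
      have h1 := add_mem (hN _ _ ih) (Submodule.smul_mem _ (c ^ n) hx)
      rw [map_sub, map_smul, ← hxy, ← Module.End.mul_apply, ← pow_succ'] at h1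
      convert h1 using 1
      rw [pow_succ c, mul_smul, smul_add]
      abel
  obtain ⟨n, hn⟩ := hu
  have h2 := hpow n
  rw [hn, LinearMap.zero_apply, zero_sub, neg_mem_iff] at h2
  have hc : c = 0 := by
    by_contra hc
    exact hg' ((Submodule.smul_mem_iff _ (pow_ne_zero n hc)).1 h2)
  have h3 : (u - 1) g ∈ F.space k := by
    rw [← hxy, hc]
    simpa using hx
  exact h3

theorem GenPos.sup_eq_top_s9 {F₁ F₂ F₃ : CompleteFlag d} (hF : GenPos ![F₁, F₂, F₃]) {a b c : ℕ}
    (h : a + b + c = d) : F₁.space a ⊔ F₂.space b ⊔ F₃.space c = ⊤ := by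
  have := hF ![a, b, c] (by simpa [Fin.sum_univ_three] using h)
  rw [← this]
  refine le_antisymm (sup_le (sup_le ?_ ?_) ?_) (iSup_le fun i => ?_)
  · exact le_iSup (fun i => (![F₁, F₂, F₃] i).space (![a, b, c] i)) 0
  · exact le_iSup (fun i => (![F₁, F₂, F₃] i).space (![a, b, c] i)) 1
  · exact le_iSup (fun i => (![F₁, F₂, F₃] i).space (![a, b, c] i)) 2
  · fin_cases i
    · exact le_sup_of_le_left le_sup_left
    · exact le_sup_of_le_left le_sup_right
    · exact le_sup_right

theorem flagElt_zero (F : CompleteFlag d) : ∃ r : ℂ, r ≠ 0 ∧ flagElt F 0 = algebraMap ℂ _ r := by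
  obtain ⟨h, h0⟩ := flagElt_mem_and_ne_zero F (Nat.zero_le d)
  rw [flagPower, pow_zero, Submodule.mem_one] at h
  obtain ⟨r, hr⟩ := h
  refine ⟨r, ?_, hr.symm⟩
  rintro rfl
  exact h0 (by rw [← hr, map_zero])

/-- The wedge products of the flag elements of three flags do not vanish in general position. -/
theorem GenPos.apply_flagElt_ne_zero {F₁ F₂ F₃ : CompleteFlag d} (hF : GenPos ![F₁, F₂, F₃])
    {φ : ExtAlg d →ₗ[ℂ] ℂ} (hφ : IsTopIso φ) {a b c : ℕ} (h : a + b + c = d) :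
    φ (flagElt F₁ a * flagElt F₂ b * flagElt F₃ c) ≠ 0 := by
  have hle : ∀ (F : CompleteFlag d) (k : ℕ), flagPower F k ≤
      (LinearMap.range (ExteriorAlgebra.ι ℂ : (Fin d → ℂ) →ₗ[ℂ] ExtAlg d)) ^ k := fun F k =>
    pow_le_pow_left' LinearMap.map_le_range k
  have hmem : flagElt F₁ a * flagElt F₂ b * flagElt F₃ c ∈ topPower d := by
    rw [topPower, ← congrArg (_ ^ ·) h, pow_add, pow_add]
    exact Submodule.mul_mem_mul (Submodule.mul_mem_mul
      (hle _ _ (flagElt_mem_and_ne_zero F₁ (by omega)).1)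
      (hle _ _ (flagElt_mem_and_ne_zero F₂ (by omega)).1))
      (hle _ _ (flagElt_mem_and_ne_zero F₃ (by omega)).1)
  intro h0
  have h1 := hφ _ hmem h0
  have h2 := map_ι_pow_mul_pow_mul_pow_ne_bot (hF.sup_eq_top_s9 h) (by
    rw [F₁.finrank_eq a (by omega), F₂.finrank_eq b (by omega), F₃.finrank_eq c (by omega), h]
    simp)
  rw [F₁.finrank_eq a (by omega), F₂.finrank_eq b (by omega), F₃.finrank_eq c (by omega)] at h2
  refine h2 (le_bot_iff.1 ?_)
  rw [Submodule.mul_le]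
  intro xy hxy z hz
  obtain ⟨t, rfl⟩ := exists_eq_smul_flagElt F₃ (by omega) hz
  induction hxy using Submodule.mul_induction_on' with
  | mem_mul_mem x hx y hy =>
    obtain ⟨r, rfl⟩ := exists_eq_smul_flagElt F₁ (by omega) hx
    obtain ⟨s, rfl⟩ := exists_eq_smul_flagElt F₂ (by omega) hy
    simp [h1]
  | add x hx y hy hx' hy' =>
    rw [add_mul]
    exact add_mem hx' hy'

theorem GenPos.disjoint {F₁ F₂ F₃ : CompleteFlag d} (hF : GenPos ![F₁, F₂, F₃]) {b c : ℕ}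
    (h : b + c = d) : Disjoint (F₂.space b) (F₃.space c) := by
  have h1 := hF.sup_eq_top_s9 (a := 0) (b := b) (c := c) (by omega)
  have h0 : F₁.space 0 = ⊥ := Submodule.finrank_eq_zero.1 (F₁.finrank_eq 0 (by omega))
  rw [h0, bot_sup_eq] at h1
  have h2 := Submodule.finrank_sup_add_finrank_inf_eq (F₂.space b) (F₃.space c)
  rw [h1, finrank_top, F₂.finrank_eq b (by omega), F₃.finrank_eq c (by omega)] at h2
  simp only [Module.finrank_fin_fun] at h2
  rw [disjoint_iff, ← Submodule.finrank_eq_zero (R := ℂ)]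
  omega

end Flags

/-- Telescoping the triple ratios with a fixed middle index. -/
theorem telescope_tripleRatios {K : Type*} [Field K] {d : ℕ} {D : ℕ → ℕ → ℕ → K}
    (hD : ∀ a b c, a + b + c = d → D a b c ≠ 0)
    (hT : ∀ a b c, a + b + c + 3 = d →
      D (a + 2) (b + 1) c * D (a + 1) b (c + 2) * D a (b + 2) (c + 1) =
        D a (b + 1) (c + 2) * D (a + 1) (b + 2) c * D (a + 2) b (c + 1))
    {k n : ℕ} (h : k + n + 2 = d) :
    D (n + 1) (k + 1) 0 * D n (k + 1) 1 * D 1 k (n + 1) * D 0 (k + 2) n =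
      D 0 (k + 1) (n + 1) * D 1 (k + 1) n * D (n + 1) k 1 * D n (k + 2) 0 := by
  have key : ∀ a c, a + c = n →
      D (a + 1) (k + 1) c * D a (k + 1) (c + 1) * D 1 k (n + 1) * D 0 (k + 2) n =
        D 0 (k + 1) (n + 1) * D 1 (k + 1) n * D (a + 1) k (c + 1) * D a (k + 2) c := by
    intro a
    induction a with
    | zero =>
      rintro c hc
      obtain rfl : c = n := by omega
      ring
    | succ a ih =>
      intro c hc
      have h1 := ih (c + 1) (by omega)
      have h2 := hT a k c (by omega)
      refine mul_left_cancel₀ (mul_ne_zero (hD a (k + 1) (c + 2) (by omega))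
        (mul_ne_zero (hD (a + 1) k (c + 2) (by omega)) (hD a (k + 2) (c + 1) (by omega)))) ?_
      linear_combination (D (a + 2) (k + 1) c * D (a + 1) k (c + 2) * D a (k + 2) (c + 1)) * h1 +
        (D 0 (k + 1) (n + 1) * D 1 (k + 1) n * D (a + 1) k (c + 2) * D a (k + 2) (c + 1)) * h2
  exact key n 0 (by omega)

theorem edge_ratio_eq_of_tripleRatios {K : Type*} [Field K] {d : ℕ} {D : ℕ → ℕ → ℕ → K}
    (hD : ∀ a b c, a + b + c = d → D a b c ≠ 0)
    (hT : ∀ a b c, a + b + c + 3 = d →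
      D (a + 2) (b + 1) c * D (a + 1) b (c + 2) * D a (b + 2) (c + 1) =
        D a (b + 1) (c + 2) * D (a + 1) (b + 2) c * D (a + 2) b (c + 1))
    {r s : K} (h0 : ∀ n, n + 1 = d → r * D n 0 1 * D 0 1 n = s * D 1 0 n * D n 1 0)
    {k n : ℕ} (h : k + n + 1 = d) :
    r * D n k 1 * D 0 (k + 1) n = s * D 1 k n * D n (k + 1) 0 := by
  induction k generalizing n with
  | zero => exact h0 n (by omega)
  | succ k ih =>
    have h1 := ih (n := n + 1) (by omega)
    have h2 := telescope_tripleRatios hD hT (k := k) (n := n) (by omega)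
    refine mul_left_cancel₀ (mul_ne_zero (hD (n + 1) (k + 1) 0 (by omega))
      (hD 1 k (n + 1) (by omega))) ?_
    linear_combination r * h2 + D 1 (k + 1) n * D n (k + 2) 0 * h1

section AdaptedBases

variable {d : ℕ}

theorem flagElt_mul_ι_sum_mul_flagElt (F G : CompleteFlag d) {n k : ℕ} (hn : n ≤ d) (hk : k ≤ d)
    {w : ℕ → Fin d → ℂ} {S : Finset ℕ} {m : ℕ} (hm : m ∈ S)
    (hw : ∀ i ∈ S, i ≠ m → w i ∈ F.space n ∨ w i ∈ G.space k) :
    flagElt F n * ExteriorAlgebra.ι ℂ (∑ i ∈ S, w i) * flagElt G k =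
      flagElt F n * ExteriorAlgebra.ι ℂ (w m) * flagElt G k := by
  rw [map_sum, Finset.mul_sum, Finset.sum_mul]
  refine Finset.sum_eq_single_of_mem m hm fun i hi him => ?_
  obtain h | h := hw i hi him
  · rw [flagElt_mul_ι_eq_zero F hn h, zero_mul]
  · rw [mul_assoc, ι_mul_flagElt G hk, flagElt_mul_ι_eq_zero G hk h, smul_zero, mul_zero]

theorem IsBasisFam.sum_ne_zero {v : ℕ → Fin d → ℂ} (hv : IsBasisFam d v) (hd : 1 ≤ d) :
    ∑ m ∈ Finset.Icc 1 d, v m ≠ 0 := by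
  intro h
  have h1 : ∑ i : Fin d, (1 : ℂ) • v ((i : ℕ) + 1) = 0 := by
    rw [← h, Fin.sum_univ_eq_sum_range (fun i => (1 : ℂ) • v (i + 1)), Finset.range_eq_Ico,
      Finset.sum_Ico_add' (fun i => (1 : ℂ) • v i)]
    simp only [one_smul]
    rfl
  exact one_ne_zero (Fintype.linearIndependent_iff.1 hv.1 (fun _ => 1) h1 ⟨0, hd⟩)

theorem exists_ι_eq_smul_flagElt_one (F : CompleteFlag d) (hd : 1 ≤ d) {v : Fin d → ℂ}
    (hv : v ∈ F.space 1) : ∃ c : ℂ, ExteriorAlgebra.ι ℂ v = c • flagElt F 1 :=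
  exists_eq_smul_flagElt F hd (by
    rw [flagPower, pow_one]
    exact Submodule.mem_map_of_mem hv)

theorem tripleRatio_eq_one_iff {φ : ExtAlg d →ₗ[ℂ] ℂ} (hφ : IsTopIso φ)
    {F₁ F₂ F₃ : CompleteFlag d} (hF : GenPos ![F₁, F₂, F₃]) {a b c : ℕ} (h : a + b + c + 3 = d) :
    tripleRatio φ F₁ F₂ F₃ (a + 1, b + 1, c + 1) = 1 ↔
      φ (flagElt F₁ (a + 2) * flagElt F₂ (b + 1) * flagElt F₃ c) *
        φ (flagElt F₁ (a + 1) * flagElt F₂ b * flagElt F₃ (c + 2)) *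
        φ (flagElt F₁ a * flagElt F₂ (b + 2) * flagElt F₃ (c + 1)) =
      φ (flagElt F₁ a * flagElt F₂ (b + 1) * flagElt F₃ (c + 2)) *
        φ (flagElt F₁ (a + 1) * flagElt F₂ (b + 2) * flagElt F₃ c) *
        φ (flagElt F₁ (a + 2) * flagElt F₂ b * flagElt F₃ (c + 1)) := by
  rw [tripleRatio, tripleRatioOf, div_eq_one_iff_eq]
  · rfl
  · exact mul_ne_zero (mul_ne_zero (hF.apply_flagElt_ne_zero hφ (by simp only; omega))
      (hF.apply_flagElt_ne_zero hφ (by simp only; omega)))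
      (hF.apply_flagElt_ne_zero hφ (by simp only; omega))

end AdaptedBases

/-- Step 2 of Proposition 5.1: if all triple ratios of `(F₁,F₂,F₃)` equal `1`,
`u ∈ SL_d(ℂ)` is unipotent fixing `F₂` and sending `F₁` to `F₃`, and `f`, `f'` are bases adapted
to `(F₂,F₃,F₁)` and `(F₃,F₁,F₂)` with `f₁ = f'_d`, then `u f_m = (-1)^{m-1} f'_{d-m+1}`. -/
theorem unipotent_on_adapted_basis_of_tripleRatios_eq_one
    (d : ℕ) (hd : 2 ≤ d) (φ : ExtAlg d →ₗ[ℂ] ℂ) (hφ : IsTopIso φ)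
    (F₁ F₂ F₃ : CompleteFlag d) (hF : GenPos ![F₁, F₂, F₃])
    (hT : ∀ j ∈ Bset d, tripleRatio φ F₁ F₂ F₃ j = 1)
    (u : Module.End ℂ (Fin d → ℂ)) (hu : IsNilpotent (u - 1)) (hdet : LinearMap.det u = 1)
    (hu₂ : ∀ k, Submodule.map u (F₂.space k) = F₂.space k)
    (hu₁₃ : ∀ k, Submodule.map u (F₁.space k) = F₃.space k)
    (f f' : ℕ → (Fin d → ℂ))
    (hf : AdaptedBasis F₂ F₃ F₁ f) (hf' : AdaptedBasis F₃ F₁ F₂ f')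
    (hff' : f 1 = f' d) :
    ∀ m, 1 ≤ m → m ≤ d → u (f m) = ((-1 : ℂ) ^ (m - 1)) • f' (d - m + 1) := by
  obtain ⟨-, hfm, hfs⟩ := hf
  obtain ⟨hfb', hfm', hfs'⟩ := hf'
  obtain ⟨r₁, hr₁, he₁⟩ := flagElt_zero F₁
  obtain ⟨r₃, -, he₃⟩ := flagElt_zero F₃
  obtain ⟨σ, hσ⟩ := exists_ι_eq_smul_flagElt_one F₃ (by omega) hfs
  obtain ⟨σ', hσ'⟩ := exists_ι_eq_smul_flagElt_one F₁ (by omega) hfs'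
  have hσ0 : σ' ≠ 0 := by
    rintro rfl
    rw [zero_smul, ExteriorAlgebra.ι_eq_zero_iff] at hσ'
    exact hfb'.sum_ne_zero (by omega) hσ'
  set D : ℕ → ℕ → ℕ → ℂ := fun a b c => φ (flagElt F₁ a * flagElt F₂ b * flagElt F₃ c) with hDdef
  have hD : ∀ a b c, a + b + c = d → D a b c ≠ 0 := fun a b c => hF.apply_flagElt_ne_zero hφ
  have hT' : ∀ a b c, a + b + c + 3 = d →
      D (a + 2) (b + 1) c * D (a + 1) b (c + 2) * D a (b + 2) (c + 1) =
        D a (b + 1) (c + 2) * D (a + 1) (b + 2) c * D (a + 2) b (c + 1) := fun a b c h =>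
    (tripleRatio_eq_one_iff hφ hF h).1 (hT _ (by simp [Bset]; omega))
  have hα : ∀ k n, k + n + 1 = d → ∀ α : ℂ,
      flagElt F₂ k * ExteriorAlgebra.ι ℂ (f (k + 1)) = α • flagElt F₂ (k + 1) →
      α * D n (k + 1) 0 = r₃ * σ * D n k 1 := by
    intro k n h α hα
    have h1 := flagElt_mul_ι_sum_mul_flagElt F₁ F₂ (n := n) (k := k) (by omega) (by omega)
      (w := f) (S := Finset.Icc 1 d) (m := k + 1) (Finset.mem_Icc.2 (by omega)) (by
        intro i hi hik
        rw [Finset.mem_Icc] at hi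
        obtain ⟨h₂, h₁⟩ := hfm i hi.1 hi.2
        obtain hlt | hlt := lt_or_gt_of_ne hik
        · exact Or.inr (F₂.mono (by omega) h₂)
        · exact Or.inl (F₁.mono (by omega) h₁))
    rw [mul_assoc, mul_assoc, ι_mul_flagElt F₂ (by omega), ι_mul_flagElt F₂ (by omega), hα, hσ] at h1
    have h2 := congrArg φ h1
    simp only [mul_smul_comm, map_smul, smul_eq_mul, ← mul_assoc (flagElt F₁ n)] at h2
    replace h2 := mul_left_cancel₀ (pow_ne_zero k (neg_ne_zero.2 one_ne_zero)) h2
    simp only [hDdef, he₃, ← Algebra.commutes r₃, ← Algebra.smul_def, map_smul, smul_eq_mul]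
    linear_combination -r₃ * h2
  have hβ : ∀ k n, k + n + 1 = d → ∀ β : ℂ,
      flagElt F₂ k * ExteriorAlgebra.ι ℂ (f' (n + 1)) = β • flagElt F₂ (k + 1) →
      β * D 0 (k + 1) n = (-1) ^ k * (r₁ * σ' * D 1 k n) := by
    intro k n h β hβ
    have h1 := flagElt_mul_ι_sum_mul_flagElt F₂ F₃ (n := k) (k := n) (by omega) (by omega)
      (w := f') (S := Finset.Icc 1 d) (m := n + 1) (Finset.mem_Icc.2 (by omega)) (by
        intro i hi hik
        rw [Finset.mem_Icc] at hi
        obtain ⟨h₃, h₂⟩ := hfm' i hi.1 hi.2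
        obtain hlt | hlt := lt_or_gt_of_ne hik
        · exact Or.inr (F₃.mono (by omega) h₃)
        · exact Or.inl (F₂.mono (by omega) h₂))
    have h2 := ι_mul_flagElt F₂ (k := k) (by omega) (∑ i ∈ Finset.Icc 1 d, f' i)
    have h3 : flagElt F₂ k * ExteriorAlgebra.ι ℂ (∑ i ∈ Finset.Icc 1 d, f' i) =
        ((-1 : ℂ) ^ k * σ') • (flagElt F₁ 1 * flagElt F₂ k) := by
      rw [mul_smul, ← smul_mul_assoc, ← hσ', h2, smul_smul, ← mul_pow]
      simp
    rw [h3, hβ] at h1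
    have h4 := congrArg φ h1
    simp only [smul_mul_assoc, map_smul, smul_eq_mul] at h4
    simp only [hDdef, he₁, ← Algebra.smul_def, smul_mul_assoc, map_smul, smul_eq_mul]
    linear_combination -r₁ * h4
  intro m hm hmd
  obtain ⟨k, rfl⟩ : ∃ k, m = k + 1 := ⟨m - 1, by omega⟩
  obtain ⟨n, hn⟩ : ∃ n, k + n + 1 = d := ⟨d - (k + 1), by omega⟩
  have hkey : r₃ * σ * D n k 1 * D 0 (k + 1) n = r₁ * σ' * D 1 k n * D n (k + 1) 0 := by
    refine edge_ratio_eq_of_tripleRatios hD hT' (fun n hn => ?_) hn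
    obtain ⟨α, h1⟩ := exists_flagElt_mul_ι_eq_smul F₂ (k := 0) (by omega)
      (hfm 1 (by omega) (by omega)).1
    have h2 := hα 0 n (by omega) α h1
    rw [zero_add, hff', congrArg f' hn.symm] at h1
    have h3 := hβ 0 n (by omega) α h1
    rw [← h2]
    simp only [zero_add, pow_zero, one_mul] at h3 ⊢
    linear_combination D n 1 0 * h3
  have hfk := hfm (k + 1) hm hmd
  have hfn := hfm' (n + 1) (by omega) (by omega)
  rw [show d - (k + 1) + 1 = n + 1 by omega] at hfk ⊢
  rw [show d - (n + 1) + 1 = k + 1 by omega] at hfn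
  obtain ⟨α, h1⟩ := exists_flagElt_mul_ι_eq_smul F₂ hmd hfk.1
  obtain ⟨β, h2⟩ := exists_flagElt_mul_ι_eq_smul F₂ hmd hfn.2
  have hα' := hα k n hn α h1
  have hβ' := hβ k n hn β h2
  have hsq : (-1 : ℂ) ^ k * (-1) ^ k = 1 := by rw [← mul_pow]; simp
  have hαβ : α = (-1) ^ k * β := by
    refine mul_right_cancel₀ (mul_ne_zero (hD n (k + 1) 0 (by omega))
      (hD 0 (k + 1) n (by omega))) ?_
    linear_combination D 0 (k + 1) n * hα' - (-1) ^ k * D n (k + 1) 0 * hβ' + hkey -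
      r₁ * σ' * D 1 k n * D n (k + 1) 0 * hsq
  have hβ0 : β ≠ 0 := by
    rintro rfl
    rw [zero_mul] at hβ'
    exact mul_ne_zero (pow_ne_zero k (neg_ne_zero.2 one_ne_zero))
      (mul_ne_zero (mul_ne_zero hr₁ hσ0) (hD 1 k n (by omega))) hβ'.symm
  have huf := sub_mem_of_isNilpotent F₂ hu hu₂ hmd hfk.1
  have hu2 : u (f (k + 1)) ∈ F₂.space (k + 1) := hu₂ (k + 1) ▸ Submodule.mem_map_of_mem hfk.1
  have hu3 : u (f (k + 1)) ∈ F₃.space (n + 1) := hu₁₃ (n + 1) ▸ Submodule.mem_map_of_mem hfk.2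
  have hmul : flagElt F₂ k * ExteriorAlgebra.ι ℂ (u (f (k + 1)) - (-1 : ℂ) ^ k • f' (n + 1)) =
      0 := by
    have h3 := flagElt_mul_ι_eq_zero F₂ (by omega) huf
    rw [map_sub, mul_sub, h1, sub_eq_zero] at h3
    rw [map_sub, mul_sub, h3, map_smul, mul_smul_comm, h2, smul_smul, hαβ, sub_self]
  have hw := mem_of_flagElt_mul_ι_eq_zero F₂ hmd hfn.2
    (by rw [h2]; exact smul_ne_zero hβ0 (flagElt_mem_and_ne_zero F₂ hmd).2)
    (sub_mem hu2 (Submodule.smul_mem _ _ hfn.2)) hmul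
  exact sub_eq_zero.1 (Submodule.disjoint_def.1 (hF.disjoint (by omega)) _ hw
    (sub_mem hu3 (Submodule.smul_mem _ _ hfn.1)))
end

section
/- Let d ≥ 2 be an integer, let F=(F₁,F₂,F₃) be a triple of complete flags in ℂ^d in general position, and let (g₁,…,g_d) be a basis of ℂ^d adapted to F. If u₁ ∈ SL_d(ℂ) is a unipotent linear map with u₁·F₁ = F₁ and u₁·F₃ = F₂, then u₁(g_d) = g₁+⋯+g_d. If u₃ ∈ SL_d(ℂ) is a unipotent linear map with u₃·F₃ = F₃ and u₃·F₂ = F₁, then u₃(g₁+⋯+g_d) = g₁. -/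
open scoped BigOperators

/-- A nilpotent endomorphism preserving a subspace `W` of codimension at most one has range
in `W`. -/
lemma IsNilpotent.apply_mem_of_sup_span_eq_top {K V : Type*} [Field K] [AddCommGroup V]
    [Module K V] {N : Module.End K V} (hN : IsNilpotent N) {W : Submodule K V} {x : V}
    (hWx : W ⊔ Submodule.span K {x} = ⊤) (hW : ∀ w ∈ W, N w ∈ W) (v : V) : N v ∈ W := by
  have decomp : ∀ y : V, ∃ a : K, y - a • x ∈ W := by
    intro y
    have hy : y ∈ W ⊔ Submodule.span K {x} := hWx ▸ Submodule.mem_top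
    obtain ⟨w, hw, z, hz, rfl⟩ := Submodule.mem_sup.1 hy
    obtain ⟨a, rfl⟩ := Submodule.mem_span_singleton.1 hz
    exact ⟨a, by simpa using hw⟩
  have hx : N x ∈ W := by
    obtain ⟨a, ha⟩ := decomp (N x)
    have hpow : ∀ k : ℕ, (N ^ k) x - a ^ k • x ∈ W := by
      intro k
      induction k with
      | zero => simp
      | succ k ih =>
        have h := W.add_mem (hW _ ih) (W.smul_mem (a ^ k) ha)
        rw [map_sub, map_smul, smul_sub, smul_smul, ← _root_.pow_succ, sub_add_sub_cancel] at h
        rwa [_root_.pow_succ' N, Module.End.mul_apply]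
    obtain ⟨n, hn⟩ := hN
    have hmem := hpow n
    rw [hn, LinearMap.zero_apply, zero_sub, neg_mem_iff] at hmem
    by_cases ha0 : a = 0
    · simpa [ha0] using ha
    · exact hW x ((W.smul_mem_iff (pow_ne_zero n ha0)).1 hmem)
  obtain ⟨a, ha⟩ := decomp v
  have h := W.add_mem (hW _ ha) (W.smul_mem a hx)
  rwa [map_sub, map_smul, sub_add_cancel] at h

/-- Let `u` be unipotent and preserve a hyperplane `W`. If `u` sends `p` into the line of `q`, and
`p`, `q` agree with `x ∉ W` modulo `W`, then `u p = q`. -/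
lemma unipotent_apply_eq_of_mem_line {K V : Type*} [Field K] [AddCommGroup V] [Module K V]
    {u : Module.End K V} (hu : IsNilpotent (u - 1)) {W L : Submodule K V} {x p q : V}
    (hWx : W ⊔ Submodule.span K {x} = ⊤) (hx : x ∉ W) (hW : W.map u = W)
    (hL : Module.finrank K L = 1) (hup : u p ∈ L) (hq : q ∈ L)
    (hpx : p - x ∈ W) (hqx : q - x ∈ W) : u p = q := by
  have hq0 : q ≠ 0 := by
    rintro rfl
    exact hx (by simpa using hqx)
  obtain ⟨c, hc⟩ := (finrank_eq_one_iff_of_nonzero' (⟨q, hq⟩ : L) (by simpa using hq0)).1 hL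
    ⟨u p, hup⟩
  replace hc : c • q = u p := congrArg Subtype.val hc
  have hmem : u p - p ∈ W := by
    refine hu.apply_mem_of_sup_span_eq_top hWx (fun w hw => W.sub_mem ?_ hw) p
    exact hW.le (Submodule.mem_map_of_mem hw)
  have hcx : (c - 1) • x ∈ W := by
    have h := W.sub_mem (W.add_mem hmem hpx) (W.smul_mem c hqx)
    rw [← hc] at h
    convert h using 1
    module
  have hc1 : c - 1 = 0 := by
    by_contra h
    exact hx ((W.smul_mem_iff h).1 hcx)
  rw [← hc, sub_eq_zero.1 hc1, one_smul]

/-- If `F^{d-1}` contains all vectors but `g j` of a spanning family, then `g j` is a complement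
of it, and is congruent to the sum of the family modulo it. -/
lemma CompleteFlag.hyperplane_of_forall_ne_mem {d : ℕ} (hd : 1 ≤ d) (F : CompleteFlag d)
    {g : ℕ → (Fin d → ℂ)} (hg : Submodule.span ℂ (g '' Set.Icc 1 d) = ⊤) {j : ℕ}
    (hj : j ∈ Finset.Icc 1 d) (hmem : ∀ m ∈ Finset.Icc 1 d, m ≠ j → g m ∈ F.space (d - 1)) :
    F.space (d - 1) ⊔ Submodule.span ℂ {g j} = ⊤ ∧ g j ∉ F.space (d - 1) ∧
      (∑ m ∈ Finset.Icc 1 d, g m) - g j ∈ F.space (d - 1) := by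
  have hsup : F.space (d - 1) ⊔ Submodule.span ℂ {g j} = ⊤ := by
    rw [eq_top_iff, ← hg, Submodule.span_le]
    rintro _ ⟨m, hm, rfl⟩
    by_cases hmj : m = j
    · subst hmj
      exact Submodule.mem_sup_right (Submodule.mem_span_singleton_self _)
    · exact Submodule.mem_sup_left (hmem m (Finset.mem_Icc.2 hm) hmj)
  refine ⟨hsup, fun hjW => ?_, ?_⟩
  · rw [sup_eq_left.2 ((Submodule.span_singleton_le_iff_mem _ _).2 hjW)] at hsup
    have h := F.finrank_eq (d - 1) (Nat.sub_le _ _)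
    rw [hsup, finrank_top, Module.finrank_fin_fun] at h
    omega
  · rw [← Finset.sum_erase_add _ _ hj, add_sub_cancel_right]
    exact Submodule.sum_mem _ fun m hm =>
      hmem m (Finset.mem_of_mem_erase hm) (Finset.ne_of_mem_erase hm)

/-- from the proof of Corollary 5.3: if `g` is a basis adapted to
`(F₁,F₂,F₃)`, the unipotent `u₁` fixing `F₁` and sending `F₃` to `F₂` satisfies
`u₁ g_d = g₁ + ⋯ + g_d`, and the unipotent `u₃` fixing `F₃` and sending `F₂` to `F₁`
satisfies `u₃ (g₁ + ⋯ + g_d) = g₁`. -/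
theorem unipotent_adapted_sum
    (d : ℕ) (hd : 2 ≤ d) (F₁ F₂ F₃ : CompleteFlag d) (hF : GenPos ![F₁, F₂, F₃])
    (g : ℕ → (Fin d → ℂ)) (hg : AdaptedBasis F₁ F₂ F₃ g) :
    (∀ u₁ : Module.End ℂ (Fin d → ℂ), IsNilpotent (u₁ - 1) → LinearMap.det u₁ = 1 →
      (∀ k, Submodule.map u₁ (F₁.space k) = F₁.space k) →
      (∀ k, Submodule.map u₁ (F₃.space k) = F₂.space k) →
        u₁ (g d) = ∑ m ∈ Finset.Icc 1 d, g m) ∧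
    (∀ u₃ : Module.End ℂ (Fin d → ℂ), IsNilpotent (u₃ - 1) → LinearMap.det u₃ = 1 →
      (∀ k, Submodule.map u₃ (F₃.space k) = F₃.space k) →
      (∀ k, Submodule.map u₃ (F₂.space k) = F₁.space k) →
        u₃ (∑ m ∈ Finset.Icc 1 d, g m) = g 1) := by
  obtain ⟨⟨-, hspan⟩, hmem, hsum⟩ := hg
  constructor
  · intro u hu _ hF₁ hF₃
    obtain ⟨hsup, hx, hS⟩ := F₁.hyperplane_of_forall_ne_mem (by omega) hspan
      (j := d) (Finset.mem_Icc.2 ⟨by omega, le_rfl⟩) fun m hm hmd => by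
        rw [Finset.mem_Icc] at hm
        exact F₁.mono (by omega) (hmem m hm.1 hm.2).1
    have hgd : g d ∈ F₃.space 1 := by simpa using (hmem d (by omega) le_rfl).2
    exact unipotent_apply_eq_of_mem_line hu hsup hx (hF₁ _) (F₂.finrank_eq 1 (by omega))
      (hF₃ 1 ▸ Submodule.mem_map_of_mem hgd) hsum (by simp) hS
  · intro u hu _ hF₃ hF₂
    obtain ⟨hsup, hx, hS⟩ := F₃.hyperplane_of_forall_ne_mem (by omega) hspan
      (j := 1) (Finset.mem_Icc.2 ⟨le_rfl, by omega⟩) fun m hm hm1 => by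
        rw [Finset.mem_Icc] at hm
        exact F₃.mono (by omega) (hmem m hm.1 hm.2).2
    exact unipotent_apply_eq_of_mem_line hu hsup hx (hF₃ _) (F₁.finrank_eq 1 (by omega))
      (hF₂ 1 ▸ Submodule.mem_map_of_mem hsum) (hmem 1 le_rfl (by omega)).1 hS (by simp)
end

section
/- Let d ≥ 2 be an integer, let F=(F₁,F₂,F₃) be a triple of complete flags in ℂ^d in general position, let r ∈ ℂ/2πiℤ satisfy 3r ≡ Σ_{j∈ℬ} log T^j(F) (mod 2πiℤ), and let g be a basis of ℂ^d adapted to F. Then there exist unique bases f and h of ℂ^d such that the triple (f,g,h) is compatible with (F,r). -/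
open scoped BigOperators

/-- The triple of bases `(f, g, h)` is compatible with `((F₁,F₂,F₃), r)`: they are adapted to
`(F₃,F₁,F₂)`, `(F₁,F₂,F₃)`, `(F₂,F₃,F₁)` respectively, `e^{2r} f₁ = g_d` and `e^{2r} g₁ = h_d`. -/
def CompatibleTriple {d : ℕ} (F₁ F₂ F₃ : CompleteFlag d) (r : ℂ)
    (f g h : ℕ → (Fin d → ℂ)) : Prop :=
  AdaptedBasis F₃ F₁ F₂ f ∧ AdaptedBasis F₁ F₂ F₃ g ∧ AdaptedBasis F₂ F₃ F₁ h ∧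
    Complex.exp (2 * r) • f 1 = g d ∧ Complex.exp (2 * r) • g 1 = h d

/-- The reversal `(v_d, …, v_1)` of a `1`-indexed family `(v_1, …, v_d)`. -/
def opFam (d : ℕ) {V : Type*} (v : ℕ → V) : ℕ → V := fun m => v (d + 1 - m)

section FlagTriples

open Module Submodule

variable {d : ℕ}

/-- Three flags in general position, listed as `A`, `B`, `C`. -/
def GenPosTriple (A B C : CompleteFlag d) : Prop :=
  ∀ a b c : ℕ, a + b + c = d → A.space a ⊔ B.space b ⊔ C.space c = ⊤

theorem GenPos.genPosTriple {A B C : CompleteFlag d} (hF : GenPos ![A, B, C]) :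
    GenPosTriple A B C := by
  intro a b c habc
  have h := hF ![a, b, c] (by simpa [Fin.sum_univ_three] using habc)
  rw [eq_top_iff, ← h]
  refine iSup_le fun i => ?_
  fin_cases i
  · exact le_sup_left.trans le_sup_left
  · exact le_sup_right.trans le_sup_left
  · exact le_sup_right

theorem GenPosTriple.rotate {A B C : CompleteFlag d} (H : GenPosTriple A B C) :
    GenPosTriple B C A := by
  intro b c a h
  have := H a b c (by omega)
  rw [← this]
  ac_rfl

theorem CompleteFlag.space_zero_s12 (A : CompleteFlag d) : A.space 0 = ⊥ :=
  finrank_eq_zero.mp (A.finrank_eq 0 (Nat.zero_le d))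

theorem finrank_sup_add_finrank_inf_flags (A C : CompleteFlag d) {a c : ℕ} (ha : a ≤ d)
    (hc : c ≤ d) :
    finrank ℂ (A.space a ⊔ C.space c : Submodule ℂ (Fin d → ℂ)) +
      finrank ℂ (A.space a ⊓ C.space c : Submodule ℂ (Fin d → ℂ)) = a + c := by
  rw [finrank_sup_add_finrank_inf_eq, A.finrank_eq a ha, C.finrank_eq c hc]

theorem GenPosTriple.sup_eq_top {A B C : CompleteFlag d} (H : GenPosTriple A B C) {a c : ℕ}
    (h : a + c = d) : A.space a ⊔ C.space c = ⊤ := by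
  simpa [B.space_zero_s12] using H a 0 c (by omega)

theorem GenPosTriple.inf_eq_bot {A B C : CompleteFlag d} (H : GenPosTriple A B C) {a c : ℕ}
    (h : a + c = d) : A.space a ⊓ C.space c = ⊥ := by
  have h1 := finrank_sup_add_finrank_inf_flags A C (a := a) (c := c) (by omega) (by omega)
  rw [H.sup_eq_top h, finrank_top, finrank_fin_fun] at h1
  exact finrank_eq_zero.mp (by omega)

theorem GenPosTriple.finrank_line {A B C : CompleteFlag d} (H : GenPosTriple A B C) {m : ℕ}
    (h1 : 1 ≤ m) (h2 : m ≤ d) :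
    finrank ℂ (A.space m ⊓ C.space (d - m + 1) : Submodule ℂ (Fin d → ℂ)) = 1 := by
  have h := finrank_sup_add_finrank_inf_flags A C (a := m) (c := d - m + 1) h2 (by omega)
  have htop : A.space m ⊔ C.space (d - m + 1) = ⊤ := by
    rw [eq_top_iff, ← H.sup_eq_top (a := m) (c := d - m) (by omega)]
    exact sup_le_sup_left (C.mono (by omega)) _
  rw [htop, finrank_top, finrank_fin_fun] at h
  omega

theorem Submodule.exists_smul_eq_of_mem_line {V : Type*} [AddCommGroup V] [Module ℂ V]
    {L : Submodule ℂ V} (h : finrank ℂ L = 1) {u x : V} (hu : u ∈ L) (hu0 : u ≠ 0)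
    (hx : x ∈ L) : ∃ c : ℂ, c • u = x := by
  obtain ⟨c, hc⟩ := (finrank_eq_one_iff_of_nonzero' (⟨u, hu⟩ : L) (by simpa using hu0)).mp h ⟨x, hx⟩
  exact ⟨c, congrArg Subtype.val hc⟩

theorem Submodule.exists_ne_zero_mem_line {V : Type*} [AddCommGroup V] [Module ℂ V]
    {L : Submodule ℂ V} (h : finrank ℂ L = 1) : ∃ u ∈ L, u ≠ 0 := by
  refine L.exists_mem_ne_zero_of_ne_bot ?_
  rintro rfl
  simp at h

theorem sum_Icc_one_eq_sum_fin {M : Type*} [AddCommMonoid M] (v : ℕ → M) :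
    ∑ m ∈ Finset.Icc 1 d, v m = ∑ i : Fin d, v ((i : ℕ) + 1) := by
  rw [Fin.sum_univ_eq_sum_range (fun i => v (i + 1)) d, Finset.range_eq_Ico,
    Finset.sum_Ico_add' v 0 d 1]
  rfl

theorem image_Icc_one_eq_range {M : Type*} (v : ℕ → M) :
    v '' Set.Icc 1 d = Set.range fun i : Fin d => v ((i : ℕ) + 1) := by
  ext x
  constructor
  · rintro ⟨m, ⟨h1, h2⟩, rfl⟩
    exact ⟨⟨m - 1, by omega⟩, congrArg v (by simp only []; omega)⟩
  · rintro ⟨i, rfl⟩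
    exact ⟨i + 1, ⟨by omega, i.2⟩, rfl⟩

theorem isBasisFam_of_linearIndependent {v : ℕ → (Fin d → ℂ)}
    (h : LinearIndependent ℂ fun i : Fin d => v ((i : ℕ) + 1)) : IsBasisFam d v := by
  refine ⟨h, ?_⟩
  rw [image_Icc_one_eq_range]
  exact h.span_eq_top_of_card_eq_finrank' (by simp)

/-- Nonzero vectors on the lines `A^m ∩ C^{d-m+1}` form a basis. -/
theorem GenPosTriple.isBasisFam {A B C : CompleteFlag d} (H : GenPosTriple A B C)
    {u : ℕ → (Fin d → ℂ)}
    (hu : ∀ m, 1 ≤ m → m ≤ d → u m ∈ A.space m ⊓ C.space (d - m + 1))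
    (hu0 : ∀ m, 1 ≤ m → m ≤ d → u m ≠ 0) : IsBasisFam d u := by
  apply isBasisFam_of_linearIndependent
  suffices h : ∀ n, n ≤ d → LinearIndependent ℂ fun i : Fin n => u ((i : ℕ) + 1) from h d le_rfl
  intro n
  induction n with
  | zero => exact fun _ => linearIndependent_empty_type
  | succ n ih =>
    intro hn
    rw [linearIndependent_finSucc']
    refine ⟨ih (by omega), fun hmem => ?_⟩
    have hmem' : u (n + 1) ∈ A.space n := by
      refine span_le.mpr ?_ hmem
      rintro _ ⟨i, rfl⟩
      exact A.mono (show (i : ℕ) + 1 ≤ n from i.2) (hu (i + 1) (by omega) (by omega)).1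
    have hbot := H.inf_eq_bot (a := n) (c := d - (n + 1) + 1) (by omega)
    have : u (n + 1) ∈ A.space n ⊓ C.space (d - (n + 1) + 1) :=
      ⟨hmem', (hu (n + 1) (by omega) hn).2⟩
    rw [hbot] at this
    exact hu0 (n + 1) (by omega) hn (by simpa using this)

theorem GenPosTriple.notMem_sup {A B C : CompleteFlag d} (H : GenPosTriple A B C) {a c : ℕ}
    (h : a + c + 1 = d) {b : Fin d → ℂ} (hb : b ∈ B.space 1) (hb0 : b ≠ 0) :
    b ∉ A.space a ⊔ C.space c := by
  intro hmem
  have hle : B.space 1 ≤ A.space a ⊔ C.space c := by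
    intro x hx
    obtain ⟨t, rfl⟩ := Submodule.exists_smul_eq_of_mem_line (B.finrank_eq 1 (by omega)) hb hb0 hx
    exact smul_mem _ t hmem
  have htop : A.space a ⊔ C.space c = ⊤ := by
    rw [eq_top_iff, ← H a 1 c (by omega)]
    exact sup_le (sup_le le_sup_left hle) le_sup_right
  have hrank := finrank_sup_add_finrank_inf_flags A C (a := a) (c := c) (by omega) (by omega)
  rw [htop, finrank_top, finrank_fin_fun] at hrank
  omega

/-- The vector of an adapted basis may be prescribed in any position. -/
theorem GenPosTriple.exists_adaptedBasis {A B C : CompleteFlag d} (H : GenPosTriple A B C) {p : ℕ}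
    (hp1 : 1 ≤ p) (hpd : p ≤ d) {w : Fin d → ℂ} (hw : w ∈ A.space p ⊓ C.space (d - p + 1))
    (hw0 : w ≠ 0) : ∃ v, AdaptedBasis A B C v ∧ v p = w := by
  have hex : ∀ m, ∃ u : Fin d → ℂ, 1 ≤ m → m ≤ d →
      u ∈ A.space m ⊓ C.space (d - m + 1) ∧ u ≠ 0 := by
    intro m
    by_cases hm : 1 ≤ m ∧ m ≤ d
    · obtain ⟨u, hu, hu0⟩ := Submodule.exists_ne_zero_mem_line (H.finrank_line hm.1 hm.2)
      exact ⟨u, fun _ _ => ⟨hu, hu0⟩⟩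
    · exact ⟨0, fun h1 h2 => absurd ⟨h1, h2⟩ hm⟩
  choose u hu using hex
  have hbasis := H.isBasisFam (fun m h1 h2 => (hu m h1 h2).1) (fun m h1 h2 => (hu m h1 h2).2)
  obtain ⟨b, hb, hb0⟩ := Submodule.exists_ne_zero_mem_line (B.finrank_eq 1 (by omega))
  obtain ⟨c, hc⟩ : ∃ c : Fin d → ℂ, ∑ i, c i • u ((i : ℕ) + 1) = b := by
    rw [← mem_span_range_iff_exists_fun, ← image_Icc_one_eq_range, hbasis.2]
    trivial
  have hc0 : ∀ i, c i ≠ 0 := by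
    intro i hi
    refine H.notMem_sup (a := i) (c := d - i - 1) (by omega) hb hb0 ?_
    rw [← hc]
    refine sum_mem fun k _ => ?_
    rcases lt_trichotomy k i with hki | rfl | hki
    · exact smul_mem _ _ (mem_sup_left
        (A.mono (show (k : ℕ) + 1 ≤ i from hki) (hu (k + 1) (by omega) k.2).1.1))
    · simp [hi]
    · have hlt : (i : ℕ) < k := hki
      exact smul_mem _ _ (mem_sup_right
        (C.mono (by omega) (hu (k + 1) (by omega) k.2).1.2))
  obtain ⟨t, ht⟩ := Submodule.exists_smul_eq_of_mem_line (H.finrank_line hp1 hpd) (hu p hp1 hpd).1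
    (hu p hp1 hpd).2 hw
  have ht0 : t ≠ 0 := by
    rintro rfl
    exact hw0 (by simpa using ht.symm)
  let q : Fin d := ⟨p - 1, by omega⟩
  let e : ℕ → ℂ := fun m => if h : m - 1 < d then (t / c q) * c ⟨m - 1, h⟩ else 1
  have he : ∀ i : Fin d, e (i + 1) = (t / c q) * c i := fun i => by simp [e]
  have he0 : ∀ m, 1 ≤ m → m ≤ d → e m ≠ 0 := by
    intro m h1 h2
    have := he ⟨m - 1, by omega⟩
    rw [show ((⟨m - 1, by omega⟩ : Fin d) : ℕ) + 1 = m by simp only []; omega] at this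
    rw [this]
    exact mul_ne_zero (div_ne_zero ht0 (hc0 q)) (hc0 _)
  have hmem : ∀ m, 1 ≤ m → m ≤ d → e m • u m ∈ A.space m ⊓ C.space (d - m + 1) :=
    fun m h1 h2 => smul_mem _ _ (hu m h1 h2).1
  refine ⟨fun m => e m • u m, ⟨H.isBasisFam hmem fun m h1 h2 =>
    smul_ne_zero (he0 m h1 h2) (hu m h1 h2).2, hmem, ?_⟩, ?_⟩
  · rw [sum_Icc_one_eq_sum_fin fun m => e m • u m]
    simp_rw [he, mul_smul, ← Finset.smul_sum]
    rw [hc]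
    exact smul_mem _ _ hb
  · have := he q
    rw [show (q : ℕ) + 1 = p by simp only [q]; omega] at this
    simp only [this]
    rw [div_mul_cancel₀ _ (hc0 q), ht]

/-- Two adapted bases that agree in one position agree everywhere. -/
theorem AdaptedBasis.eq_of_apply_eq {A B C : CompleteFlag d} (H : GenPosTriple A B C)
    {v v' : ℕ → (Fin d → ℂ)} (hv : AdaptedBasis A B C v) (hv' : AdaptedBasis A B C v') {p : ℕ}
    (hp1 : 1 ≤ p) (hpd : p ≤ d) (hp : v' p = v p) {m : ℕ} (h1 : 1 ≤ m) (h2 : m ≤ d) :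
    v' m = v m := by
  have hlin := hv.1.1
  have hv0 : ∀ i : Fin d, v (i + 1) ≠ 0 := fun i => hlin.ne_zero i
  have hscale : ∀ i : Fin d, ∃ a : ℂ, a • v (i + 1) = v' (i + 1) := fun i =>
    Submodule.exists_smul_eq_of_mem_line (H.finrank_line (by omega) i.2)
      (hv.2.1 (i + 1) (by omega) i.2) (hv0 i) (hv'.2.1 (i + 1) (by omega) i.2)
  choose a ha using hscale
  have hsum0 : ∑ k ∈ Finset.Icc 1 d, v k ≠ 0 := by
    rw [sum_Icc_one_eq_sum_fin]
    intro h0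
    have := Fintype.linearIndependent_iff.mp hlin (fun _ => 1) (by simpa using h0)
      ⟨p - 1, by omega⟩
    exact one_ne_zero this
  obtain ⟨t, ht⟩ := Submodule.exists_smul_eq_of_mem_line (B.finrank_eq 1 (by omega)) hv.2.2 hsum0
    hv'.2.2
  rw [sum_Icc_one_eq_sum_fin, sum_Icc_one_eq_sum_fin, Finset.smul_sum] at ht
  simp_rw [← ha] at ht
  have hat : ∀ i, a i = t := by
    intro i
    have := Fintype.linearIndependent_iff.mp hlin (fun i => a i - t)
      (by simp [sub_smul, ← ht]) i
    exact sub_eq_zero.mp this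
  have hall : ∀ k, 1 ≤ k → k ≤ d → v' k = t • v k ∧ v k ≠ 0 := by
    intro k hk1 hk2
    have hk := ha ⟨k - 1, by omega⟩
    have hk0 := hv0 ⟨k - 1, by omega⟩
    rw [hat] at hk
    simp only [Nat.sub_add_cancel hk1] at hk hk0
    exact ⟨hk.symm, hk0⟩
  have ht1 : t = 1 := by
    obtain ⟨hpt, hp0⟩ := hall p hp1 hpd
    rw [hp] at hpt
    refine smul_left_injective ℂ hp0 ?_
    simpa using hpt.symm
  rw [(hall m h1 h2).1, ht1, one_smul]

end FlagTriples

/-- given a basis `g` adapted to a triple of flags `(F₁,F₂,F₃)` in general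
position and `r` with `e^{3r} = ∏_{j∈ℬ} T^j(F)`, there exist bases `f` and `h`, unique as
`d`-tuples, such that `(f, g, h)` is compatible with `((F₁,F₂,F₃), r)`. -/
theorem compatibleTriple_exists_unique
    (d : ℕ) (hd : 2 ≤ d) (φ : ExtAlg d →ₗ[ℂ] ℂ) (hφ : IsTopIso φ)
    (F₁ F₂ F₃ : CompleteFlag d) (hF : GenPos ![F₁, F₂, F₃])
    (r : ℂ) (hr : Complex.exp (3 * r) = ∏ j ∈ Bset d, tripleRatio φ F₁ F₂ F₃ j)
    (g : ℕ → (Fin d → ℂ)) (hg : AdaptedBasis F₁ F₂ F₃ g) :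
    ∃ f h : ℕ → (Fin d → ℂ), CompatibleTriple F₁ F₂ F₃ r f g h ∧
      ∀ f' h' : ℕ → (Fin d → ℂ), CompatibleTriple F₁ F₂ F₃ r f' g h' →
        ∀ m, 1 ≤ m → m ≤ d → f' m = f m ∧ h' m = h m := by
  have H₁ : GenPosTriple F₁ F₂ F₃ := hF.genPosTriple
  have H₂ : GenPosTriple F₂ F₃ F₁ := H₁.rotate
  have H₃ : GenPosTriple F₃ F₁ F₂ := H₂.rotate
  have hd1 : 1 ≤ d := by omega
  have hne : ∀ m, 1 ≤ m → m ≤ d → g m ≠ 0 := by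
    intro m h1 h2
    have := hg.1.1.ne_zero ⟨m - 1, by omega⟩
    simpa only [Nat.sub_add_cancel h1] using this
  have hexp : Complex.exp (2 * r) ≠ 0 := Complex.exp_ne_zero _
  have hgd : g d ∈ F₃.space 1 := by
    simpa using (hg.2.1 d hd1 le_rfl).2
  have hg1 : g 1 ∈ F₁.space 1 := (hg.2.1 1 le_rfl hd1).1
  obtain ⟨f, hf, hf1⟩ := H₃.exists_adaptedBasis (p := 1) le_rfl hd1
    (w := (Complex.exp (2 * r))⁻¹ • g d)
    ⟨Submodule.smul_mem _ _ hgd, by rw [F₂.eq_top _ (by omega)]; trivial⟩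
    (smul_ne_zero (inv_ne_zero hexp) (hne d hd1 le_rfl))
  obtain ⟨h, hh, hhd⟩ := H₂.exists_adaptedBasis (p := d) hd1 le_rfl
    (w := Complex.exp (2 * r) • g 1)
    ⟨by rw [F₂.eq_top _ le_rfl]; trivial, by simpa using Submodule.smul_mem _ _ hg1⟩
    (smul_ne_zero hexp (hne 1 le_rfl hd1))
  refine ⟨f, h, ⟨hf, hg, hh, by rw [hf1, smul_inv_smul₀ hexp], hhd.symm⟩, ?_⟩
  rintro f' h' ⟨hf', -, hh', hf1', hhd'⟩ m h1 h2
  refine ⟨hf.eq_of_apply_eq H₃ hf' le_rfl hd1 ?_ h1 h2,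
    hh.eq_of_apply_eq H₂ hh' hd1 le_rfl (hhd'.symm.trans hhd.symm) h1 h2⟩
  rw [hf1, ← hf1', inv_smul_smul₀ hexp]
end

section
/- Let d ≥ 2 be an integer, let (v₁,…,v_d) be a basis of ℂ^d, and let a₁,…,a_d ∈ ℂ∖{0}. Let F be the complete flag with F^m = span(v₁,…,v_m) and G the complete flag with G^m = span(v_d,…,v_{d−m+1}), and let H₁ and H₂ be complete flags with H₁^1 = ℂ·(a₁v₁+⋯+a_dv_d) and H₂^1 = ℂ·(v₁+⋯+v_d) such that (F,G,H₁) and (F,G,H₂) are in general position (such flags exist). Then for every i=(i₁,i₂) ∈ 𝒜, the double ratios satisfy D^i(F,G,H₁,H₂) = −a_{i₁+1}/a_{i₁} and D^i(G,F,H₁,H₂) = −a_{i₂}/a_{i₂+1}. -/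
open scoped BigOperators

theorem Fin.range_append {α : Type*} {m n : ℕ} (s : Fin m → α) (t : Fin n → α) :
    Set.range (Fin.append s t) = Set.range s ∪ Set.range t := by
  ext x
  rw [← not_iff_not]
  simp [Fin.forall_fin_add]

open ExteriorAlgebra in
theorem ExteriorAlgebra.ιMulti_ne_zero_of_linearIndependent {K M : Type*} [Field K]
    [AddCommGroup M] [Module K M] {n : ℕ} {w : Fin n → M} (hw : LinearIndependent K w) :
    ιMulti K n w ≠ 0 := by
  intro h0
  let s : Set.powersetCard (Fin n) n := ⟨Finset.univ, by simp⟩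
  refine (exteriorPower.ιMulti_family_linearIndependent_field n hw).ne_zero s (Subtype.ext ?_)
  have hid : ⇑(Set.powersetCard.ofFinEmbEquiv.symm s) = id :=
    (OrderEmbedding.strictMono _).eq_id
  rw [exteriorPower.ιMulti_family_apply_coe, ExteriorAlgebra.ιMulti_family, hid]
  exact h0

open ExteriorAlgebra in
theorem ExteriorAlgebra.map_ι_span_range_pow_le {R M : Type*} [CommRing R]
    [AddCommGroup M] [Module R M] {n : ℕ} (w : Fin n → M) :
    (Submodule.map (ι R) (Submodule.span R (Set.range w))) ^ n ≤
      Submodule.span R {ιMulti R n w} := by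
  rw [Submodule.map_span, Submodule.span_pow, Submodule.span_le]
  intro u hu
  obtain ⟨f, rfl⟩ := Set.mem_pow.mp hu
  have hf : ∀ i, ∃ j, ι R (w j) = f i := fun i => by
    obtain ⟨_, ⟨j, rfl⟩, hj⟩ := (f i).2
    exact ⟨j, hj⟩
  choose σ hσ using hf
  have hprod : (List.ofFn fun i => (f i : ExteriorAlgebra R M)).prod = ιMulti R n (w ∘ σ) := by
    simp [ιMulti_apply, hσ]
  rw [SetLike.mem_coe, hprod]
  by_cases hinj : Function.Injective σ
  · have hperm := (ιMulti R n).map_perm w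
      (Equiv.ofBijective σ (Finite.injective_iff_bijective.mp hinj))
    rw [Equiv.coe_ofBijective] at hperm
    rw [hperm, Units.smul_def]
    exact zsmul_mem (Submodule.mem_span_singleton_self _) _
  · rw [(ιMulti R n).map_eq_zero_of_not_injective _ fun h => hinj h.of_comp]
    exact zero_mem _

theorem flagElt_eq_smul_ιMulti {d : ℕ} (F : CompleteFlag d) {k : ℕ} (hk : k ≤ d)
    (w : Fin k → Fin d → ℂ) (hw : F.space k = Submodule.span ℂ (Set.range w)) :
    ∃ c : ℂ, c ≠ 0 ∧ flagElt F k = c • ExteriorAlgebra.ιMulti ℂ k w := by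
  have hli : LinearIndependent ℂ w := by
    rw [linearIndependent_iff_card_eq_finrank_span, Set.finrank, ← hw, F.finrank_eq k hk,
      Fintype.card_fin]
  have hmem : ExteriorAlgebra.ιMulti ℂ k w ∈ flagPower F k := by
    rw [ExteriorAlgebra.ιMulti_apply, flagPower]
    refine Submodule.pow_subset_pow _ (Set.mem_pow.mpr ⟨fun i => ⟨_, w i, ?_, rfl⟩, rfl⟩)
    rw [hw]
    exact Submodule.subset_span ⟨i, rfl⟩
  have hex : ∃ x, x ∈ flagPower F k ∧ x ≠ 0 :=
    ⟨_, hmem, ExteriorAlgebra.ιMulti_ne_zero_of_linearIndependent hli⟩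
  have helt : flagElt F k = hex.choose := dif_pos hex
  obtain ⟨hpow, hne⟩ := hex.choose_spec
  rw [← helt] at hpow hne
  rw [flagPower, hw] at hpow
  obtain ⟨c, hc⟩ := Submodule.mem_span_singleton.mp
    (ExteriorAlgebra.map_ι_span_range_pow_le w hpow)
  refine ⟨c, ?_, hc.symm⟩
  rintro rfl
  exact hne (by rw [← hc, zero_smul])

theorem CompleteFlag.exists_span_range_eq {d : ℕ} (F : CompleteFlag d) {k : ℕ} (hk : k ≤ d) :
    ∃ w : Fin k → Fin d → ℂ, F.space k = Submodule.span ℂ (Set.range w) := by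
  let b := Module.finBasisOfFinrankEq ℂ (F.space k) (F.finrank_eq k hk)
  refine ⟨fun i => b i, ?_⟩
  have h := congrArg (Submodule.map (F.space k).subtype) b.span_eq
  rw [Submodule.map_span, ← Set.range_comp, Submodule.map_top, Submodule.range_subtype] at h
  exact h.symm

theorem flagElt_one_eq_smul_ι {d : ℕ} (hd : 1 ≤ d) (H : CompleteFlag d) {x : Fin d → ℂ}
    (hx : H.space 1 = Submodule.span ℂ {x}) :
    ∃ c : ℂ, c ≠ 0 ∧ flagElt H 1 = c • ExteriorAlgebra.ι ℂ x := by
  obtain ⟨c, hc, h⟩ := flagElt_eq_smul_ιMulti H hd ![x] (by simpa using hx)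
  exact ⟨c, hc, by simpa using h⟩

/-- The wedge of two flag elements and a vector is a nonzero multiple of a wedge of vectors
adapted to the two flags. -/
theorem exists_flagElt_mul_mul_ι_eq {d : ℕ} (A B : CompleteFlag d) {p q : ℕ} (hp : p ≤ d)
    (hq : q ≤ d) :
    ∃ (c : ℂ) (w : Fin (p + q) → Fin d → ℂ), c ≠ 0 ∧
      A.space p ⊔ B.space q = Submodule.span ℂ (Set.range w) ∧
      ∀ x, flagElt A p * flagElt B q * ExteriorAlgebra.ι ℂ x =
        c • ExteriorAlgebra.ιMulti ℂ (p + q + 1) (Fin.append w ![x]) := by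
  obtain ⟨s, hs⟩ := A.exists_span_range_eq hp
  obtain ⟨t, ht⟩ := B.exists_span_range_eq hq
  obtain ⟨c, hc, hA⟩ := flagElt_eq_smul_ιMulti A hp s hs
  obtain ⟨e, he, hB⟩ := flagElt_eq_smul_ιMulti B hq t ht
  refine ⟨c * e, Fin.append s t, mul_ne_zero hc he, ?_, fun x => ?_⟩
  · rw [hs, ht, ← Submodule.span_union, Fin.range_append]
  · have hx : ExteriorAlgebra.ι ℂ x = ExteriorAlgebra.ιMulti ℂ 1 ![x] := by simp
    rw [hA, hB, hx, smul_mul_smul_comm, smul_mul_assoc, ExteriorAlgebra.ιMulti_mul_ιMulti,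
      ExteriorAlgebra.ιMulti_mul_ιMulti]

theorem flagElt_mul_mul_ι_eq_zero {d : ℕ} (A B : CompleteFlag d) {p q : ℕ} (hp : p ≤ d)
    (hq : q ≤ d) {x : Fin d → ℂ} (hx : x ∈ A.space p ⊔ B.space q) :
    flagElt A p * flagElt B q * ExteriorAlgebra.ι ℂ x = 0 := by
  obtain ⟨c, w, -, hw, h⟩ := exists_flagElt_mul_mul_ι_eq A B hp hq
  let L : (Fin d → ℂ) →ₗ[ℂ] ExtAlg d :=
    LinearMap.mulLeft ℂ (flagElt A p * flagElt B q) ∘ₗ ExteriorAlgebra.ι ℂ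
  suffices A.space p ⊔ B.space q ≤ LinearMap.ker L from this hx
  rw [hw, Submodule.span_le]
  rintro _ ⟨i, rfl⟩
  change flagElt A p * flagElt B q * ExteriorAlgebra.ι ℂ (w i) = 0
  rw [h, ExteriorAlgebra.ιMulti_eq_zero_of_not_inj, smul_zero]
  intro hinj
  have hne : Fin.castAdd 1 i ≠ Fin.natAdd (p + q) 0 := by
    simp only [ne_eq, Fin.ext_iff, Fin.val_castAdd, Fin.val_natAdd]
    have := i.isLt
    simp; omega
  exact hne (hinj (by simp only [Fin.append_left, Fin.append_right, Matrix.cons_val_zero]))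

theorem IsTopIso.map_flagElt_mul_mul_ι_ne_zero {d : ℕ} {φ : ExtAlg d →ₗ[ℂ] ℂ} (hφ : IsTopIso φ)
    (A B : CompleteFlag d) {p q : ℕ} (hpq : p + q + 1 = d) {x : Fin d → ℂ}
    (hx : A.space p ⊔ B.space q ⊔ Submodule.span ℂ {x} = ⊤) :
    φ (flagElt A p * flagElt B q * ExteriorAlgebra.ι ℂ x) ≠ 0 := by
  obtain ⟨c, w, hc, hw, h⟩ := exists_flagElt_mul_mul_ι_eq A B (by omega : p ≤ d) (by omega : q ≤ d)
  have hspan : Submodule.span ℂ (Set.range (Fin.append w ![x])) = ⊤ := by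
    rw [Fin.range_append, Submodule.span_union, ← hw, ← hx]
    simp
  have hli : LinearIndependent ℂ (Fin.append w ![x]) := by
    rw [linearIndependent_iff_card_eq_finrank_span, Set.finrank, hspan]
    simpa using hpq
  intro h0
  rw [h, map_smul, smul_eq_mul, mul_eq_zero] at h0
  refine ExteriorAlgebra.ιMulti_ne_zero_of_linearIndependent hli (hφ _ ?_ (h0.resolve_left hc))
  have htop : topPower d = ⋀[ℂ]^(p + q + 1) (Fin d → ℂ) :=
    congrArg (fun n => ⋀[ℂ]^n (Fin d → ℂ)) hpq.symm
  rw [htop]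
  exact ExteriorAlgebra.ιMulti_range ℂ (p + q + 1) (Set.mem_range_self _)

theorem map_flagElt_mul_mul_flagElt_one {d : ℕ} (φ : ExtAlg d →ₗ[ℂ] ℂ)
    (A B H : CompleteFlag d) {p q : ℕ} (hp : p ≤ d) (hq : q ≤ d) {x y : Fin d → ℂ} {b c : ℂ}
    (hH : flagElt H 1 = c • ExteriorAlgebra.ι ℂ x)
    (hxy : x - b • y ∈ A.space p ⊔ B.space q) :
    φ (flagElt A p * flagElt B q * flagElt H 1) =
      c * (b * φ (flagElt A p * flagElt B q * ExteriorAlgebra.ι ℂ y)) := by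
  have h := flagElt_mul_mul_ι_eq_zero A B hp hq hxy
  rw [map_sub, mul_sub, sub_eq_zero, map_smul, mul_smul_comm] at h
  rw [hH, mul_smul_comm, h, map_smul, map_smul, smul_eq_mul, smul_eq_mul]

/-- The double ratio in terms of the coordinates of the two lines modulo the two hyperplanes
spanned by the first two flags. -/
theorem IsTopIso.doubleRatio_eq {d : ℕ} {φ : ExtAlg d →ₗ[ℂ] ℂ} (hφ : IsTopIso φ)
    (A B H₁ H₂ : CompleteFlag d) {i : ℕ × ℕ} (hi₁ : 0 < i.1) (hi₂ : 0 < i.2)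
    (hi : i.1 + i.2 = d) {x₁ x₂ y z : Fin d → ℂ} {b c : ℂ}
    (hH₁ : H₁.space 1 = Submodule.span ℂ {x₁}) (hH₂ : H₂.space 1 = Submodule.span ℂ {x₂})
    (hy : A.space i.1 ⊔ B.space (i.2 - 1) ⊔ Submodule.span ℂ {y} = ⊤)
    (hz : A.space (i.1 - 1) ⊔ B.space i.2 ⊔ Submodule.span ℂ {z} = ⊤)
    (hy₁ : x₁ - b • y ∈ A.space i.1 ⊔ B.space (i.2 - 1))
    (hy₂ : x₂ - (1 : ℂ) • y ∈ A.space i.1 ⊔ B.space (i.2 - 1))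
    (hz₁ : x₁ - c • z ∈ A.space (i.1 - 1) ⊔ B.space i.2)
    (hz₂ : x₂ - (1 : ℂ) • z ∈ A.space (i.1 - 1) ⊔ B.space i.2) :
    doubleRatio φ A B H₁ H₂ i = -(b / c) := by
  obtain ⟨e₁, he₁, hE₁⟩ := flagElt_one_eq_smul_ι (by omega) H₁ hH₁
  obtain ⟨e₂, he₂, hE₂⟩ := flagElt_one_eq_smul_ι (by omega) H₂ hH₂
  have hY := hφ.map_flagElt_mul_mul_ι_ne_zero A B (by omega) hy
  have hZ := hφ.map_flagElt_mul_mul_ι_ne_zero A B (by omega) hz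
  rw [doubleRatio, doubleRatioOf,
    map_flagElt_mul_mul_flagElt_one φ A B H₁ (by omega) (by omega) hE₁ hy₁,
    map_flagElt_mul_mul_flagElt_one φ A B H₂ (by omega) (by omega) hE₂ hy₂,
    map_flagElt_mul_mul_flagElt_one φ A B H₁ (by omega) (by omega) hE₁ hz₁,
    map_flagElt_mul_mul_flagElt_one φ A B H₂ (by omega) (by omega) hE₂ hz₂]
  congr 1
  rw [← mul_div_mul_left b c (mul_ne_zero (mul_ne_zero he₁ he₂) (mul_ne_zero hY hZ))]
  congr 1 <;> ring

section OppositeFlags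

variable {d : ℕ} {v : ℕ → Fin d → ℂ} {F G : CompleteFlag d}

theorem mem_sup_of_ne
    (hFv : ∀ m, m ≤ d → F.space m = Submodule.span ℂ (v '' Set.Icc 1 m))
    (hGv : ∀ m, m ≤ d → G.space m = Submodule.span ℂ (v '' Set.Icc (d - m + 1) d))
    {p q m j : ℕ} (hm : m = p + 1) (hpq : p + q + 1 = d) (hj : j ∈ Finset.Icc 1 d) (hjm : j ≠ m) :
    v j ∈ F.space p ⊔ G.space q := by
  rw [Finset.mem_Icc] at hj
  rw [hFv p (by omega), hGv q (by omega)]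
  rcases lt_or_gt_of_ne hjm with h | h
  · exact Submodule.mem_sup_left (Submodule.subset_span ⟨j, ⟨by omega, by omega⟩, rfl⟩)
  · exact Submodule.mem_sup_right (Submodule.subset_span ⟨j, ⟨by omega, by omega⟩, rfl⟩)

theorem sum_sub_mem_sup
    (hFv : ∀ m, m ≤ d → F.space m = Submodule.span ℂ (v '' Set.Icc 1 m))
    (hGv : ∀ m, m ≤ d → G.space m = Submodule.span ℂ (v '' Set.Icc (d - m + 1) d))
    (a : ℕ → ℂ) {p q m : ℕ} (hm : m = p + 1) (hpq : p + q + 1 = d) :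
    ∑ j ∈ Finset.Icc 1 d, a j • v j - a m • v m ∈ F.space p ⊔ G.space q := by
  rw [← Finset.sum_erase_eq_sub (Finset.mem_Icc.mpr ⟨by omega, by omega⟩)]
  refine Submodule.sum_mem _ fun j hj => Submodule.smul_mem _ _ ?_
  rw [Finset.mem_erase] at hj
  exact mem_sup_of_ne hFv hGv hm hpq hj.2 hj.1

theorem sup_sup_span_singleton_eq_top (hv : IsBasisFam d v)
    (hFv : ∀ m, m ≤ d → F.space m = Submodule.span ℂ (v '' Set.Icc 1 m))
    (hGv : ∀ m, m ≤ d → G.space m = Submodule.span ℂ (v '' Set.Icc (d - m + 1) d))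
    {p q m : ℕ} (hm : m = p + 1) (hpq : p + q + 1 = d) :
    F.space p ⊔ G.space q ⊔ Submodule.span ℂ {v m} = ⊤ := by
  rw [eq_top_iff, ← hv.2, Submodule.span_le]
  rintro _ ⟨j, hj, rfl⟩
  by_cases hjm : j = m
  · subst hjm
    exact Submodule.mem_sup_right (Submodule.mem_span_singleton_self _)
  · exact Submodule.mem_sup_left
      (mem_sup_of_ne hFv hGv hm hpq (Finset.mem_Icc.mpr hj) hjm)

end OppositeFlags

/-- from the proof of Lemma 9.2(iii): double ratios of the flags spanned by a
basis `v` and the lines spanned by `∑ a_m v_m` and `∑ v_m`. -/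
theorem doubleRatio_in_basis
    (d : ℕ) (hd : 2 ≤ d) (φ : ExtAlg d →ₗ[ℂ] ℂ) (hφ : IsTopIso φ)
    (v : ℕ → (Fin d → ℂ)) (hv : IsBasisFam d v)
    (a : ℕ → ℂ) (ha : ∀ m, 1 ≤ m → m ≤ d → a m ≠ 0)
    (F G H₁ H₂ : CompleteFlag d)
    (hFv : ∀ m, m ≤ d → F.space m = Submodule.span ℂ (v '' Set.Icc 1 m))
    (hGv : ∀ m, m ≤ d → G.space m = Submodule.span ℂ (v '' Set.Icc (d - m + 1) d))
    (hH₁ : H₁.space 1 = Submodule.span ℂ {∑ m ∈ Finset.Icc 1 d, a m • v m})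
    (hH₂ : H₂.space 1 = Submodule.span ℂ {∑ m ∈ Finset.Icc 1 d, v m})
    (h₁ : GenPos ![F, G, H₁]) (h₂ : GenPos ![F, G, H₂]) :
    ∀ i ∈ Aset d,
      doubleRatio φ F G H₁ H₂ i = -(a (i.1 + 1) / a i.1) ∧
      doubleRatio φ G F H₁ H₂ i = -(a i.2 / a (i.2 + 1)) := by
  intro i hi
  obtain ⟨-, hi₁, hi₂, hi⟩ := Finset.mem_filter.mp hi
  have hH₂' : H₂.space 1 = Submodule.span ℂ {∑ m ∈ Finset.Icc 1 d, (1 : ℂ) • v m} := by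
    simpa using hH₂
  constructor
  · exact hφ.doubleRatio_eq F G H₁ H₂ hi₁ hi₂ hi hH₁ hH₂'
      (sup_sup_span_singleton_eq_top hv hFv hGv rfl (by omega))
      (sup_sup_span_singleton_eq_top hv hFv hGv (by omega) (by omega))
      (sum_sub_mem_sup hFv hGv a rfl (by omega))
      (sum_sub_mem_sup hFv hGv (fun _ => 1) rfl (by omega))
      (sum_sub_mem_sup hFv hGv a (by omega) (by omega))
      (sum_sub_mem_sup hFv hGv (fun _ => 1) (by omega) (by omega))
  · refine hφ.doubleRatio_eq G F H₁ H₂ (y := v i.2) (z := v (i.2 + 1))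
      hi₁ hi₂ hi hH₁ hH₂' ?_ ?_ ?_ ?_ ?_ ?_ <;> rw [sup_comm (G.space _)]
    · exact sup_sup_span_singleton_eq_top hv hFv hGv (by omega) (by omega)
    · exact sup_sup_span_singleton_eq_top hv hFv hGv rfl (by omega)
    · exact sum_sub_mem_sup hFv hGv a (by omega) (by omega)
    · exact sum_sub_mem_sup hFv hGv (fun _ => 1) (by omega) (by omega)
    · exact sum_sub_mem_sup hFv hGv a rfl (by omega)
    · exact sum_sub_mem_sup hFv hGv (fun _ => 1) rfl (by omega)
end

section
/- Let d ≥ 2 be an integer, let G be an additively written abelian group, let z : ℬ → G be any function, and set z̄(j) := z(j) + z(j₊) + z(j₋) for j ∈ ℬ. Then Σ_{i=(i₁,i₂)∈𝒜'} i₁·( Σ_{j∈ℬ, j₂=i₁} z̄(j) − Σ_{j∈ℬ, j₂=i₂} z̄(j) ) equals d·Σ_{j∈ℬ*} z(j) when d is odd, and equals d·Σ_{j∈ℬ*} z(j) + (d/2)·Σ_{j∈ℬ⁰} z̄(j) when d is even. (Here n·x denotes the n-fold sum of x in G.) -/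
/-- `𝒜' = {(i₁,i₂) ∈ 𝒜 : i₁ ≤ ⌊(d-1)/2⌋}`. -/
def A1set (d : ℕ) : Finset (ℕ × ℕ) := (Aset d).filter fun i => i.1 ≤ (d - 1) / 2

/-- `𝒜'' = {(i₁,i₂) ∈ 𝒜 : i₁ ≤ ⌈(d-1)/2⌉}` (note `⌈(d-1)/2⌉ = d/2` in natural division). -/
def A2set (d : ℕ) : Finset (ℕ × ℕ) := (Aset d).filter fun i => i.1 ≤ d / 2

/-- `ℬ* = {(j₁,j₂,j₃) ∈ ℬ : j₁, j₂, j₃ ≤ ⌊(d-1)/2⌋}`. -/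
def Bstar (d : ℕ) : Finset (ℕ × ℕ × ℕ) :=
  (Bset d).filter fun j => j.1 ≤ (d - 1) / 2 ∧ j.2.1 ≤ (d - 1) / 2 ∧ j.2.2 ≤ (d - 1) / 2

/-- The triples in `ℬ` with middle entry equal to `k`. -/
def Bmid (d k : ℕ) : Finset (ℕ × ℕ × ℕ) := (Bset d).filter fun j => j.2.1 = k

/-- `ℬ⁰ = {j ∈ ℬ : j₂ = d/2}` (for `d` even). -/
def Bzero (d : ℕ) : Finset (ℕ × ℕ × ℕ) := Bmid d (d / 2)

theorem mem_Bset_iff {d : ℕ} {j : ℕ × ℕ × ℕ} :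
    j ∈ Bset d ↔ 0 < j.1 ∧ 0 < j.2.1 ∧ 0 < j.2.2 ∧ j.1 + j.2.1 + j.2.2 = d := by
  simp only [Bset, Finset.mem_filter, Finset.mem_product, Finset.mem_range]
  omega

theorem mem_A1set_iff {d : ℕ} {i : ℕ × ℕ} :
    i ∈ A1set d ↔ 0 < i.1 ∧ 0 < i.2 ∧ i.1 + i.2 = d ∧ i.1 ≤ (d - 1) / 2 := by
  simp only [A1set, Aset, Finset.mem_filter, Finset.mem_product, Finset.mem_range]
  omega

/-- The representative of `k` modulo `d` of least absolute value, with `d / 2` replaced by `0`. -/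
def foldedWeight (d k : ℕ) : ℤ :=
  if 2 * k < d then k else if 2 * k = d then 0 else (k : ℤ) - d

theorem sum_A1set_smul_ite {G : Type*} [AddCommGroup G] {d k : ℕ} (hk : 0 < k) (hkd : k < d)
    (x : G) :
    ∑ i ∈ A1set d, i.1 • ((if k = i.1 then x else 0) - (if k = i.2 then x else 0)) =
      foldedWeight d k • x := by
  rcases lt_trichotomy (2 * k) d with h | h | h
  · rw [Finset.sum_eq_single_of_mem (k, d - k) (by rw [mem_A1set_iff]; dsimp only; omega)]
    · have h' : k ≠ d - k := by omega
      simp [foldedWeight, h, h']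
    · rintro ⟨a, b⟩ hi hne
      rw [mem_A1set_iff] at hi
      rw [Ne, Prod.mk.injEq] at hne
      dsimp only at hi ⊢
      rw [if_neg (by omega), if_neg (by omega), sub_zero, smul_zero]
  · rw [Finset.sum_eq_zero]
    · simp [foldedWeight, h]
    · rintro ⟨a, b⟩ hi
      rw [mem_A1set_iff] at hi
      dsimp only at hi ⊢
      rw [if_neg (by omega), if_neg (by omega), sub_zero, smul_zero]
  · rw [Finset.sum_eq_single_of_mem (d - k, k) (by rw [mem_A1set_iff]; dsimp only; omega)]
    · have hw : foldedWeight d k = -((d - k : ℕ) : ℤ) := by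
        simp only [foldedWeight]
        split_ifs <;> omega
      dsimp only
      rw [if_neg (by omega), if_pos rfl, hw, zero_sub, neg_smul, smul_neg, natCast_zsmul]
    · rintro ⟨a, b⟩ hi hne
      rw [mem_A1set_iff] at hi
      rw [Ne, Prod.mk.injEq] at hne
      dsimp only at hi ⊢
      rw [if_neg (by omega), if_neg (by omega), sub_zero, smul_zero]

theorem sum_A1set_eq_sum_Bset {G : Type*} [AddCommGroup G] (d : ℕ) (f : ℕ × ℕ × ℕ → G) :
    ∑ i ∈ A1set d, i.1 • ((∑ j ∈ Bmid d i.1, f j) - ∑ j ∈ Bmid d i.2, f j) =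
      ∑ j ∈ Bset d, foldedWeight d j.2.1 • f j := by
  simp only [Bmid, Finset.sum_filter, ← Finset.sum_sub_distrib, Finset.smul_sum]
  rw [Finset.sum_comm]
  refine Finset.sum_congr rfl fun j hj => ?_
  rw [mem_Bset_iff] at hj
  exact sum_A1set_smul_ite (by omega) (by omega) (f j)

/-- Summation over `ℬ` is invariant under cyclic rotation of the triples. -/
theorem sum_Bset_rotate {G : Type*} [AddCommMonoid G] (d : ℕ) (f : ℕ × ℕ × ℕ → G) :
    ∑ j ∈ Bset d, f (j.2.1, j.2.2, j.1) = ∑ j ∈ Bset d, f j := by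
  refine Finset.sum_nbij' (fun j => (j.2.1, j.2.2, j.1)) (fun j => (j.2.2, j.1, j.2.1))
    ?_ ?_ (fun _ _ => rfl) (fun _ _ => rfl) (fun _ _ => rfl)
  all_goals
    intro j hj
    rw [mem_Bset_iff] at hj ⊢
    dsimp only
    omega

theorem sum_middle_smul_cyclic {G : Type*} [AddCommGroup G] (d : ℕ) (w : ℕ → ℤ)
    (z : ℕ × ℕ × ℕ → G) :
    ∑ j ∈ Bset d, w j.2.1 • (z j + z (j.2.1, j.2.2, j.1) + z (j.2.2, j.1, j.2.1)) =
      ∑ j ∈ Bset d, (w j.1 + w j.2.1 + w j.2.2) • z j := by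
  have h₁ := sum_Bset_rotate d fun j => w j.1 • z j
  have h₂ := sum_Bset_rotate d fun j => w j.2.1 • z (j.2.2, j.1, j.2.1)
  simp only [smul_add, add_smul, Finset.sum_add_distrib]
  rw [h₁, ← h₂]
  abel

theorem smul_sum_Bstar_eq {G : Type*} [AddCommGroup G] (d : ℕ) (z : ℕ × ℕ × ℕ → G) :
    d • ∑ j ∈ Bstar d, z j =
      ∑ j ∈ Bset d, (if j.1 ≤ (d - 1) / 2 ∧ j.2.1 ≤ (d - 1) / 2 ∧ j.2.2 ≤ (d - 1) / 2
        then (d : ℤ) else 0) • z j := by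
  simp only [Bstar, Finset.sum_filter, Finset.smul_sum, ite_smul, smul_ite, smul_zero, zero_smul,
    natCast_zsmul]

theorem smul_sum_Bzero_eq {G : Type*} [AddCommGroup G] (d : ℕ) (f : ℕ × ℕ × ℕ → G) :
    (d / 2) • ∑ j ∈ Bzero d, f j =
      ∑ j ∈ Bset d, (fun k : ℕ => if k = d / 2 then ((d / 2 : ℕ) : ℤ) else 0) j.2.1 • f j := by
  simp only [Bzero, Bmid, Finset.sum_filter, Finset.smul_sum, ite_smul, smul_ite, smul_zero,
    zero_smul, natCast_zsmul]

/-- Lemma 5.5: for any function `z : ℬ → G`, with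
`z̄(j) = z(j) + z(j₊) + z(j₋)`, the combination `∑_{i ∈ 𝒜'} i₁ (∑_{j₂ = i₁} z̄(j) − ∑_{j₂ = i₂} z̄(j))`
equals `d ∑_{ℬ*} z` for odd `d`, and `d ∑_{ℬ*} z + (d/2) ∑_{ℬ⁰} z̄` for even `d`. -/
theorem weighted_sum_eq
    (d : ℕ) (hd : 2 ≤ d) (G : Type*) [AddCommGroup G] (z : ℕ × ℕ × ℕ → G) :
    (Odd d →
      (∑ i ∈ A1set d, i.1 •
          ((∑ j ∈ Bmid d i.1, (z j + z (j.2.1, j.2.2, j.1) + z (j.2.2, j.1, j.2.1))) -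
           (∑ j ∈ Bmid d i.2, (z j + z (j.2.1, j.2.2, j.1) + z (j.2.2, j.1, j.2.1))))) =
        d • ∑ j ∈ Bstar d, z j) ∧
    (Even d →
      (∑ i ∈ A1set d, i.1 •
          ((∑ j ∈ Bmid d i.1, (z j + z (j.2.1, j.2.2, j.1) + z (j.2.2, j.1, j.2.1))) -
           (∑ j ∈ Bmid d i.2, (z j + z (j.2.1, j.2.2, j.1) + z (j.2.2, j.1, j.2.1))))) =
        d • ∑ j ∈ Bstar d, z j +
          (d / 2) • ∑ j ∈ Bzero d, (z j + z (j.2.1, j.2.2, j.1) + z (j.2.2, j.1, j.2.1))) := by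
  constructor
  · intro ho
    rw [sum_A1set_eq_sum_Bset, sum_middle_smul_cyclic, smul_sum_Bstar_eq]
    refine Finset.sum_congr rfl fun j hj => ?_
    rw [mem_Bset_iff] at hj
    obtain ⟨m, rfl⟩ := ho
    congr 1
    simp only [foldedWeight]
    split_ifs <;> omega
  · intro he
    rw [sum_A1set_eq_sum_Bset, sum_middle_smul_cyclic, smul_sum_Bstar_eq, smul_sum_Bzero_eq,
      sum_middle_smul_cyclic d (fun k : ℕ => if k = d / 2 then ((d / 2 : ℕ) : ℤ) else 0),
      ← Finset.sum_add_distrib]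
    refine Finset.sum_congr rfl fun j hj => ?_
    rw [mem_Bset_iff] at hj
    obtain ⟨m, rfl⟩ := he
    rw [← add_smul]
    congr 1
    simp only [foldedWeight]
    split_ifs <;> omega
end
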